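/- Let ∅ ≠ 𝒜 ⊆ ℝⁿ and B ⊆ ℕⁿ \ (2ℕ)ⁿ be disjoint finite sets. Then the S-cone decomposes as C_S(𝒜, B) = Σ_{α∈𝒜} ℝ≥0·e_α + Σ_{(A,β)∈R(𝒜,𝒜)} Pᵉ(A, β) + Σ_{(A,β)∈R(𝒜,B)} Pᵒ(A, β), where all sums are Minkowski sums in ℝ^{𝒜∪B}, each Pᵉ(A,β) and Pᵒ(A,β) is embedded into ℝ^{𝒜∪B} by extending coefficient vectors by zero, and e_α denotes the α-th standard unit vector. -/

import Mathlib

attribute [local instance] Classical.propDecidable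

noncomputable section

/-- Embedding of exponent vectors with natural entries into `ℝⁿ`. -/
def natEmb (n : ℕ) (β : Fin n → ℕ) : Fin n → ℝ := fun i => (β i : ℝ)

/-- `(c, d)` is the coefficient vector of a nonnegative AG function supported on `(𝒜, B)`. -/
def IsNonnegAG (n : ℕ) (𝒜 : Finset (Fin n → ℝ)) (B : Finset (Fin n → ℕ))
    (c : (Fin n → ℝ) → ℝ) (d : (Fin n → ℕ) → ℝ) : Prop :=
  (((∀ β ∈ B, d β = 0) ∧ (𝒜.filter fun α => c α < 0).card ≤ 1) ∨
      ((∀ α ∈ 𝒜, 0 ≤ c α) ∧ (B.filter fun β => d β ≠ 0).card ≤ 1)) ∧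
    ∀ x : Fin n → ℝ, (∀ i, x i ≠ 0) →
      0 ≤ ∑ α ∈ 𝒜, c α * ∏ i, |x i| ^ (α i)
            + ∑ β ∈ B, d β * ∏ i, (x i) ^ (β i)

/-- Membership in the S-cone `C_S(𝒜, B)`: a finite nonnegative combination of
coefficient vectors of nonnegative AG functions. -/
def InSCone (n : ℕ) (𝒜 : Finset (Fin n → ℝ)) (B : Finset (Fin n → ℕ))
    (c : (Fin n → ℝ) → ℝ) (d : (Fin n → ℕ) → ℝ) : Prop :=
  ∃ (k : ℕ) (cs : Fin k → ((Fin n → ℝ) → ℝ)) (ds : Fin k → ((Fin n → ℕ) → ℝ))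
      (t : Fin k → ℝ),
    (∀ j, 0 ≤ t j ∧ IsNonnegAG n 𝒜 B (cs j) (ds j)) ∧
    (∀ α ∈ 𝒜, c α = ∑ j, t j * cs j α) ∧
    (∀ β ∈ B, d β = ∑ j, t j * ds j β)

/-- `(A, β)` is a reduced circuit with respect to the ground set `𝒜`. -/
def IsRedCircuit (n : ℕ) (𝒜 A : Finset (Fin n → ℝ)) (β : Fin n → ℝ) : Prop :=
  AffineIndependent ℝ (fun x : A => (x : Fin n → ℝ)) ∧
  β ∈ intrinsicInterior ℝ (convexHull ℝ (A : Set (Fin n → ℝ))) ∧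
  β ∉ A ∧
  ∀ γ ∈ 𝒜, γ ∈ convexHull ℝ (A : Set (Fin n → ℝ)) → γ ∈ A ∨ γ = β

/-- The (finite) set `R(𝒜, 𝒜)` of even reduced circuits. -/
def evenRed (n : ℕ) (𝒜 : Finset (Fin n → ℝ)) :
    Finset (Finset (Fin n → ℝ) × (Fin n → ℝ)) :=
  (𝒜.powerset ×ˢ 𝒜).filter fun Aβ => IsRedCircuit n 𝒜 Aβ.1 Aβ.2

/-- The (finite) set `R(𝒜, B)` of odd reduced circuits. -/
def oddRed (n : ℕ) (𝒜 : Finset (Fin n → ℝ)) (B : Finset (Fin n → ℕ)) :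
    Finset (Finset (Fin n → ℝ) × (Fin n → ℕ)) :=
  (𝒜.powerset ×ˢ B).filter fun Aβ => IsRedCircuit n 𝒜 Aβ.1 (natEmb n Aβ.2)

/-- Membership in the even circuit cone `Pᵉ(A, β)` (monomial version). -/
def InPeMon (n : ℕ) (A : Finset (Fin n → ℝ)) (β : Fin n → ℝ)
    (c : (Fin n → ℝ) → ℝ) : Prop :=
  (∀ α ∈ A, 0 ≤ c α) ∧
    ∀ x : Fin n → ℝ, (∀ i, x i ≠ 0) →
      0 ≤ ∑ α ∈ A, c α * ∏ i, |x i| ^ (α i) + c β * ∏ i, |x i| ^ (β i)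

/-- Membership in the odd circuit cone `Pᵒ(A, β)`, with the coefficient of the inner
exponent `β ∈ ℕⁿ` given separately as `r`. -/
def InPoMon (n : ℕ) (A : Finset (Fin n → ℝ)) (β : Fin n → ℕ)
    (g : (Fin n → ℝ) → ℝ) (r : ℝ) : Prop :=
  (∀ α ∈ A, 0 ≤ g α) ∧
    ∀ x : Fin n → ℝ, (∀ i, x i ≠ 0) →
      0 ≤ ∑ α ∈ A, g α * ∏ i, |x i| ^ (α i) + r * ∏ i, (x i) ^ (β i)

namespace SC

theorem mem_relint {n : ℕ} (A : Finset (Fin n → ℝ)) (l : (Fin n → ℝ) → ℝ) (hl : ∀ a ∈ A, 0 < l a)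
    (h1 : ∑ a ∈ A, l a = 1) :
    (∑ a ∈ A, l a • a) ∈ intrinsicInterior ℝ (convexHull ℝ (A : Set (Fin n → ℝ))) := by
  have hne : A.Nonempty := by
    rw [Finset.nonempty_iff_ne_empty]; rintro rfl; simp at h1
  set C := convexHull ℝ (A : Set (Fin n → ℝ)) with hC
  have hCc : Convex ℝ C := convex_convexHull _ _
  have hCne : C.Nonempty := by
    obtain ⟨a, ha⟩ := hne
    exact ⟨a, subset_convexHull _ _ ha⟩
  obtain ⟨p, hp⟩ := hCne.intrinsicInterior hCc
  have hpC : p ∈ C := intrinsicInterior_subset hp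
  obtain ⟨m, hm0, hm1, hmp⟩ := Finset.mem_convexHull'.1 hpC
  obtain ⟨a0, ha0, hmin⟩ := A.exists_min_image l hne
  set θ := min (l a0) (1/2) with hθ
  have hθ0 : 0 < θ := lt_min (hl a0 ha0) (by norm_num)
  have hθ1 : θ ≤ 1/2 := min_le_right _ _
  have hθl : ∀ a ∈ A, θ ≤ l a := fun a ha => (min_le_left _ _).trans (hmin a ha)
  have hm_le : ∀ a ∈ A, m a ≤ 1 := fun a ha => hm1 ▸ Finset.single_le_sum hm0 ha
  set γ := ∑ a ∈ A, l a • a with hγ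
  set q := ∑ a ∈ A, ((l a - θ * m a) / (1 - θ)) • a with hq
  have h1θ : (0:ℝ) < 1 - θ := by linarith
  have hqC : q ∈ C := by
    refine Finset.mem_convexHull'.2 ⟨fun a => (l a - θ * m a) / (1 - θ), ?_, ?_, rfl⟩
    · intro a ha
      apply div_nonneg _ h1θ.le
      nlinarith [hθl a ha, hm_le a ha, hm0 a ha]
    · rw [← Finset.sum_div, Finset.sum_sub_distrib, ← Finset.mul_sum, h1, hm1, mul_one,
        div_self h1θ.ne']
  have hcomb : γ = θ • p + (1 - θ) • q := by
    rw [hγ, hq, ← hmp, Finset.smul_sum, Finset.smul_sum, ← Finset.sum_add_distrib]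
    refine Finset.sum_congr rfl fun a _ => ?_
    rw [smul_smul, smul_smul, ← add_smul, mul_div_cancel₀ _ h1θ.ne']
    congr 1; ring
  have hγC : γ ∈ C := by
    rw [hcomb]; exact hCc hpC hqC hθ0.le h1θ.le (by ring)
  rw [mem_intrinsicInterior] at hp ⊢
  obtain ⟨p', hp', hpp⟩ := hp
  have hsub : ∀ {x}, x ∈ C → x ∈ affineSpan ℝ C := fun hx => subset_affineSpan ℝ C hx
  refine ⟨⟨γ, hsub hγC⟩, ?_, rfl⟩
  rw [mem_interior_iff_mem_nhds, mem_nhds_subtype] at hp' ⊢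
  obtain ⟨U, hU, hUs⟩ := hp'
  rw [hpp] at hU
  let g : (Fin n → ℝ) → (Fin n → ℝ) := fun z => θ⁻¹ • (z - q) + q
  have hgc : Continuous g := by fun_prop
  have hgγ' : g γ = p + ((θ⁻¹ * (1 - θ) - θ⁻¹ + 1 : ℝ)) • q := by
    simp only [g]; rw [hcomb]
    ext i; simp; field_simp; ring
  have hgp : g γ = p := by
    rw [hgγ']; have : (θ⁻¹ * (1 - θ) - θ⁻¹ + 1 : ℝ) = 0 := by field_simp; ring
    rw [this]; simp
  refine ⟨g ⁻¹' U, hgc.continuousAt.preimage_mem_nhds (by rw [hgp]; exact hU), ?_⟩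
  rintro ⟨z, hz⟩ hzU
  have hgz : g z ∈ affineSpan ℝ C := by
    have := AffineMap.lineMap_mem (Q := affineSpan ℝ C) (θ⁻¹) (hsub hqC) hz
    simpa [AffineMap.lineMap_apply, g] using this
  have hgC : g z ∈ C := hUs (a := ⟨g z, hgz⟩) hzU
  have : z = θ • g z + (1 - θ) • q := by
    ext i; simp [g]; field_simp; ring
  show z ∈ C
  rw [this]; exact hCc hgC hqC hθ0.le h1θ.le (by ring)

/-- Caratheodory in finset form. -/
theorem carath {n : ℕ} (T : Finset (Fin n → ℝ)) (γ : Fin n → ℝ)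
    (hγ : γ ∈ convexHull ℝ (T : Set (Fin n → ℝ))) :
    ∃ A ⊆ T, ∃ l : (Fin n → ℝ) → ℝ, AffineIndependent ℝ (fun x : A => (x : Fin n → ℝ)) ∧
      (∀ a ∈ A, 0 < l a) ∧ ∑ a ∈ A, l a = 1 ∧ ∑ a ∈ A, l a • a = γ := by
  obtain ⟨ι, _, z, w, hz, hai, hw, hw1, hwz⟩ := eq_pos_convex_span_of_mem_convexHull hγ
  have hinj : Function.Injective z := hai.injective
  refine ⟨Finset.univ.image z, ?_, fun x => ∑ i, if z i = x then w i else 0, ?_, ?_, ?_, ?_⟩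
  · intro x hx
    simp only [Finset.mem_image, Finset.mem_univ, true_and] at hx
    obtain ⟨i, rfl⟩ := hx
    exact hz ⟨i, rfl⟩
  · have := hai.range
    have h2 : ((Finset.univ.image z : Finset _) : Set (Fin n → ℝ)) = Set.range z := by simp
    have h3 : AffineIndependent ℝ (fun x : ((Finset.univ.image z : Finset _) : Set (Fin n → ℝ)) => (x : Fin n → ℝ)) := by
      rw [h2]; exact this
    exact h3
  · intro a ha
    simp only [Finset.mem_image, Finset.mem_univ, true_and] at ha
    obtain ⟨i, rfl⟩ := ha
    simp [hinj.eq_iff, hw]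
  · rw [Finset.sum_image (by intro a _ b _ h; exact hinj h)]
    simp [hinj.eq_iff, hw1]
  · rw [Finset.sum_image (by intro a _ b _ h; exact hinj h)]
    simp [hinj.eq_iff, hwz]

theorem notMem_hull_of_extreme {n : ℕ} {S C : Set (Fin n → ℝ)} {a : Fin n → ℝ}
    (ha : a ∈ C.extremePoints ℝ) (hS : S ⊆ C) (hC : Convex ℝ C) (haS : a ∉ S) :
    a ∉ convexHull ℝ S := by
  intro h
  have h1 : convexHull ℝ S ⊆ C := convexHull_min hS hC
  exact haS (extremePoints_convexHull_subset
    (inter_extremePoints_subset_extremePoints_of_subset h1 ⟨h, ha⟩))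

theorem extreme_of_affInd {n : ℕ} (A : Finset (Fin n → ℝ))
    (hA : AffineIndependent ℝ (fun x : A => (x : Fin n → ℝ))) {a : Fin n → ℝ} (ha : a ∈ A) :
    a ∈ (convexHull ℝ (A : Set (Fin n → ℝ))).extremePoints ℝ := by
  by_contra hne
  -- the hull is the hull of its extreme points, which are in `A.erase a`
  have hcomp : IsCompact (convexHull ℝ (A : Set (Fin n → ℝ))) := A.finite_toSet.isCompact_convexHull (𝕜 := ℝ)
  have hkm := closure_convexHull_extremePoints hcomp (convex_convexHull _ _)
  have hsub : (convexHull ℝ (A : Set (Fin n → ℝ))).extremePoints ℝ ⊆ (A.erase a : Finset _) := by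
    intro x hx
    have := extremePoints_convexHull_subset hx
    simp only [Finset.coe_erase, Set.mem_sdiff, Set.mem_singleton_iff]
    exact ⟨this, fun h => hne (h ▸ hx)⟩
  have h2 : a ∈ convexHull ℝ ((A.erase a : Finset _) : Set (Fin n → ℝ)) := by
    have hcl : IsClosed (convexHull ℝ ((A.erase a : Finset _) : Set (Fin n → ℝ))) :=
      (A.erase a).finite_toSet.isClosed_convexHull (𝕜 := ℝ)
    have := closure_minimal (convexHull_mono hsub) hcl
    rw [hkm] at this
    exact this (subset_convexHull _ _ ha)
  have h3 : a ∈ convexHull ℝ (((A.erase a : Finset _) : Set (Fin n → ℝ)) ∩ (({a} : Finset (Fin n → ℝ)) : Set (Fin n → ℝ))) := by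
    rw [hA.convexHull_inter (A.erase_subset a) (Finset.singleton_subset_iff.2 ha)]
    exact ⟨h2, by simp⟩
  simp at h3

theorem exists_red {n : ℕ} (𝒜 T : Finset (Fin n → ℝ)) (hT : T ⊆ 𝒜) (γ : Fin n → ℝ)
    (hγ : γ ∈ convexHull ℝ (T : Set (Fin n → ℝ))) (hγT : γ ∉ T) :
    ∃ A ⊆ 𝒜, ∃ l : (Fin n → ℝ) → ℝ, IsRedCircuit n 𝒜 A γ ∧
      (A : Set (Fin n → ℝ)) ⊆ convexHull ℝ (T : Set (Fin n → ℝ)) ∧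
      (∀ a ∈ A, 0 < l a) ∧ ∑ a ∈ A, l a = 1 ∧ ∑ a ∈ A, l a • a = γ := by
  -- strong induction on the number of points in the hull
  induction hN : (𝒜.filter fun x => x ∈ convexHull ℝ (T : Set (Fin n → ℝ))).card
    using Nat.strong_induction_on generalizing T with
  | _ N ih =>
  obtain ⟨A, hAT, l, hai, hl, hl1, hlγ⟩ := carath T γ hγ
  have hAhull : (A : Set (Fin n → ℝ)) ⊆ convexHull ℝ (T : Set (Fin n → ℝ)) :=
    (Finset.coe_subset.2 hAT).trans (subset_convexHull _ _)
  have hγA : γ ∉ A := fun h => hγT (hAT h)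
  by_cases hred : ∀ δ ∈ 𝒜, δ ∈ convexHull ℝ (A : Set (Fin n → ℝ)) → δ ∈ A ∨ δ = γ
  · refine ⟨A, hAT.trans hT, l, ⟨hai, ?_, hγA, hred⟩, hAhull, hl, hl1, hlγ⟩
    have := mem_relint A l hl hl1
    rwa [hlγ] at this
  push Not at hred
  obtain ⟨δ, hδ, hδA, hδnA, hδγ⟩ := hred
  obtain ⟨m, hm0, hm1, hmδ⟩ := Finset.mem_convexHull'.1 hδA
  have hPne : (A.filter fun a => 0 < m a).Nonempty := by
    by_contra h
    rw [Finset.not_nonempty_iff_eq_empty, Finset.filter_eq_empty_iff] at h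
    have : ∑ a ∈ A, m a = 0 := Finset.sum_eq_zero fun a ha => le_antisymm (not_lt.1 (h ha)) (hm0 a ha)
    linarith
  obtain ⟨b, hb, hbmin⟩ := Finset.exists_min_image _ (fun a => l a / m a) hPne
  rw [Finset.mem_filter] at hb
  obtain ⟨hbA, hmb⟩ := hb
  set t := l b / m b with ht
  have ht0 : 0 < t := div_pos (hl b hbA) hmb
  have hcoef : ∀ a ∈ A, 0 ≤ l a - t * m a := by
    intro a ha
    rcases (hm0 a ha).lt_or_eq with h | h
    · have := hbmin a (Finset.mem_filter.2 ⟨ha, h⟩)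
      have h3 := (le_div_iff₀ h).1 this
      linarith
    · rw [← h]; simp [(hl a ha).le]
  have hcoefb : l b - t * m b = 0 := by rw [ht]; field_simp; ring
  set T' := insert δ (A.erase b) with hT'
  have hδe : δ ∉ A.erase b := fun h => hδnA (Finset.mem_of_mem_erase h)
  have hγT' : γ ∈ convexHull ℝ (T' : Set (Fin n → ℝ)) := by
    refine Finset.mem_convexHull'.2 ⟨fun a => if a = δ then t else l a - t * m a, ?_, ?_, ?_⟩
    · intro a ha
      dsimp only
      split_ifs with h
      · exact ht0.le
      · rw [hT', Finset.mem_insert] at ha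
        exact hcoef a (Finset.mem_of_mem_erase (ha.resolve_left h))
    · rw [hT', Finset.sum_insert hδe, if_pos rfl]
      have : ∑ a ∈ A.erase b, (if a = δ then t else l a - t * m a) = ∑ a ∈ A.erase b, (l a - t * m a) := by
        refine Finset.sum_congr rfl fun a ha => if_neg ?_
        rintro rfl
        exact hδe ha
      rw [this, Finset.sum_erase (f := fun a => l a - t * m a) A hcoefb, Finset.sum_sub_distrib, ← Finset.mul_sum, hl1, hm1]; ring
    · rw [hT', Finset.sum_insert hδe]
      dsimp only
      rw [if_pos rfl]
      have : ∑ a ∈ A.erase b, (if a = δ then t else l a - t * m a) • a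
          = ∑ a ∈ A.erase b, (l a - t * m a) • a := by
        refine Finset.sum_congr rfl fun a ha => ?_
        rw [if_neg (by rintro rfl; exact hδe ha)]
      rw [this, Finset.sum_erase (f := fun a => (l a - t * m a) • a) A (by simp only [hcoefb, zero_smul])]
      simp only [sub_smul, mul_smul]
      rw [Finset.sum_sub_distrib, ← Finset.smul_sum, hlγ, hmδ]
      abel
  have hT'A : T' ⊆ 𝒜 := by
    intro x hx
    rw [hT', Finset.mem_insert] at hx
    rcases hx with rfl | hx
    · exact hδ
    · exact hT (hAT (Finset.mem_of_mem_erase hx))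
  have hT'hA : (T' : Set (Fin n → ℝ)) ⊆ convexHull ℝ (A : Set (Fin n → ℝ)) := by
    intro x hx
    rw [Finset.mem_coe, hT', Finset.mem_insert] at hx
    rcases hx with rfl | hx
    · exact hδA
    · exact subset_convexHull _ _ (Finset.mem_of_mem_erase hx)
  have hhull : convexHull ℝ (T' : Set (Fin n → ℝ)) ⊆ convexHull ℝ (T : Set (Fin n → ℝ)) :=
    (convexHull_min hT'hA (convex_convexHull _ _)).trans (convexHull_mono (Finset.coe_subset.2 hAT))
  have hbT' : b ∉ convexHull ℝ (T' : Set (Fin n → ℝ)) := by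
    refine notMem_hull_of_extreme (extreme_of_affInd A hai hbA) hT'hA (convex_convexHull _ _) ?_
    simp only [hT', Finset.coe_insert, Finset.coe_erase, Set.mem_insert_iff, Set.mem_sdiff, not_or]
    exact ⟨fun h => hδnA (h ▸ hbA), by simp⟩
  have hγnT' : γ ∉ T' := by
    rw [hT', Finset.mem_insert, not_or]
    exact ⟨fun h => hδγ h.symm, fun h => hγA (Finset.mem_of_mem_erase h)⟩
  have hlt : (𝒜.filter fun x => x ∈ convexHull ℝ (T' : Set (Fin n → ℝ))).card < N := by
    rw [← hN]
    apply Finset.card_lt_card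
    refine ⟨fun x hx => ?_, fun h => ?_⟩
    · rw [Finset.mem_filter] at hx ⊢
      exact ⟨hx.1, hhull hx.2⟩
    · have : b ∈ 𝒜.filter fun x => x ∈ convexHull ℝ (T : Set (Fin n → ℝ)) :=
        Finset.mem_filter.2 ⟨hT (hAT hbA), hAhull hbA⟩
      exact hbT' (Finset.mem_filter.1 (h this)).2
  obtain ⟨A', hA', l', h1, h2, h3⟩ := ih _ hlt T' hT'A hγT' hγnT' rfl
  exact ⟨A', hA', l', h1, h2.trans hhull, h3⟩

/-- Maximum principle. -/
theorem max_principle {n : ℕ} (𝒜 : Finset (Fin n → ℝ)) (β : Fin n → ℝ) (h : (Fin n → ℝ) → ℝ)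
    (hc : ∀ A ⊆ 𝒜, ∀ γ ∈ insert β 𝒜, ∀ l : (Fin n → ℝ) → ℝ, IsRedCircuit n 𝒜 A γ →
      (∀ a ∈ A, 0 < l a) → ∑ a ∈ A, l a = 1 → ∑ a ∈ A, l a • a = γ →
      h γ ≤ ∑ a ∈ A, l a * h a)
    (T : Finset (Fin n → ℝ)) (hT : T ⊆ 𝒜) (hβ : β ∈ convexHull ℝ (T : Set (Fin n → ℝ))) :
    ∃ α ∈ T, h β ≤ h α := by
  by_contra! hcon
  set X := (insert β 𝒜).filter fun x => x ∈ convexHull ℝ (T : Set (Fin n → ℝ)) with hX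
  have hβX : β ∈ X := by rw [hX, Finset.mem_filter]; exact ⟨Finset.mem_insert_self _ _, hβ⟩
  obtain ⟨g0, hg0, hmax⟩ := X.exists_max_image h ⟨β, hβX⟩
  set M := X.filter fun x => h x = h g0 with hM
  have hMne : (M : Set (Fin n → ℝ)).Nonempty := ⟨g0, by simp [hM, hg0]⟩
  have hcomp : IsCompact (convexHull ℝ (M : Set (Fin n → ℝ))) := M.finite_toSet.isCompact_convexHull (𝕜 := ℝ)
  obtain ⟨γ, hγ⟩ := hcomp.extremePoints_nonempty hMne.convexHull
  have hγM : γ ∈ M := extremePoints_convexHull_subset hγ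
  have hγX : γ ∈ X := (Finset.mem_filter.1 hγM).1
  have hγg : h γ = h g0 := (Finset.mem_filter.1 hγM).2
  have hγT : γ ∉ T := fun hh => by
    have := hcon γ hh
    have := hmax β hβX
    linarith
  obtain ⟨A, hA, l, hred, hAT, hl, hl1, hlγ⟩ := exists_red 𝒜 T hT γ (Finset.mem_filter.1 hγX).2 hγT
  have hAX : ∀ a ∈ A, a ∈ X := fun a ha =>
    Finset.mem_filter.2 ⟨Finset.mem_insert_of_mem (hA ha), hAT ha⟩
  have key := hc A hA γ (Finset.mem_filter.1 hγX).1 l hred hl hl1 hlγ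
  have hall : ∀ a ∈ A, l a * (h g0 - h a) = 0 := by
    have hnn : ∀ a ∈ A, 0 ≤ l a * (h g0 - h a) := fun a ha =>
      mul_nonneg (hl a ha).le (sub_nonneg.2 (hmax a (hAX a ha)))
    rw [← Finset.sum_eq_zero_iff_of_nonneg hnn]
    refine le_antisymm ?_ (Finset.sum_nonneg hnn)
    simp only [mul_sub]
    rw [Finset.sum_sub_distrib, ← Finset.sum_mul, hl1]
    linarith
  have hAM : (A : Set (Fin n → ℝ)) ⊆ convexHull ℝ (M : Set (Fin n → ℝ)) := by
    intro a ha
    refine subset_convexHull _ _ (Finset.mem_coe.2 (Finset.mem_filter.2 ⟨hAX a ha, ?_⟩))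
    have := (mul_eq_zero.1 (hall a ha)).resolve_left (hl a ha).ne'
    linarith
  exact notMem_hull_of_extreme hγ hAM (convex_convexHull _ _) (by simpa using hred.2.2.1)
    (intrinsicInterior_subset hred.2.1)

end SC

namespace SC
open Filter Topology

theorem sep_lemma {n : ℕ} (S : Finset (Fin n → ℝ)) (h : (Fin n → ℝ) → ℝ) (β : Fin n → ℝ) (v : ℝ)
    (hns : ∀ s ≤ v, (β, s) ∉ convexHull ℝ ((fun α => (α, h α)) '' (S : Set (Fin n → ℝ)))) :
    ∃ y : Fin n → ℝ, ∀ α ∈ S, y ⬝ᵥ α - y ⬝ᵥ β ≤ h α - v := by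
  set C := convexHull ℝ ((fun α => (α, h α)) '' (S : Set (Fin n → ℝ))) with hC
  have hCcomp : IsCompact C := (S.finite_toSet.image _).isCompact_convexHull (𝕜 := ℝ)
  have hQ : IsClosed (({β} : Set (Fin n → ℝ)) ×ˢ Set.Iic v) := isClosed_singleton.prod isClosed_Iic
  have hQc : Convex ℝ (({β} : Set (Fin n → ℝ)) ×ˢ Set.Iic v) :=
    (convex_singleton β).prod (convex_Iic v)
  have hdis : Disjoint C (({β} : Set (Fin n → ℝ)) ×ˢ Set.Iic v) := by
    rw [Set.disjoint_left]
    rintro ⟨x, s⟩ hx hx2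
    rw [Set.mem_prod] at hx2
    obtain ⟨h1, h2⟩ := hx2
    simp only [Set.mem_singleton_iff] at h1
    subst h1
    exact hns s h2 hx
  obtain ⟨f, u, u', hfu, huu, hfu'⟩ :=
    geometric_hahn_banach_compact_closed (convex_convexHull ℝ _) hCcomp hQc hQ hdis
  have hfd : ∀ x s, f (x, s) = f (x, 0) + s * f (0, 1) := by
    intro x s
    have : (x, s) = (x, (0:ℝ)) + s • ((0 : Fin n → ℝ), (1:ℝ)) := by simp
    rw [this, map_add, map_smul, smul_eq_mul]
  set τ := f (0, 1) with hτ
  have hτ0 : τ ≤ 0 := by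
    by_contra! hpos
    have h1 := hfu' (β, v - |f (β, 0) + v * τ - u'| / τ) ⟨rfl, by
      simp only [Set.mem_Iic]; have := div_nonneg (abs_nonneg (f (β, 0) + v * τ - u')) hpos.le; linarith⟩
    rw [hfd] at h1
    have h2 : (v - |f (β, 0) + v * τ - u'| / τ) * τ = v * τ - |f (β, 0) + v * τ - u'| := by
      field_simp
    rw [h2] at h1
    have := le_abs_self (f (β, 0) + v * τ - u')
    linarith
  set y0 : Fin n → ℝ := fun i => f (Pi.single i 1, 0) with hy0
  have hf0 : ∀ x : Fin n → ℝ, f (x, 0) = y0 ⬝ᵥ x := by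
    intro x
    have := LinearMap.pi_apply_eq_sum_univ ((f : (Fin n → ℝ) × ℝ →ₗ[ℝ] ℝ).comp (LinearMap.inl ℝ (Fin n → ℝ) ℝ)) x
    simp only [LinearMap.comp_apply, LinearMap.inl_apply, ContinuousLinearMap.coe_coe] at this
    rw [this, dotProduct]
    refine Finset.sum_congr rfl fun i _ => ?_
    rw [smul_eq_mul, mul_comm]
    simp only [hy0]
    congr 3
    ext j; simp [Pi.single_apply, eq_comm]
  have hstr : ∀ α ∈ S, y0 ⬝ᵥ α - y0 ⬝ᵥ β + (h α - v) * τ < 0 := by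
    intro α hα
    have h1 := hfu (α, h α) (subset_convexHull _ _ ⟨α, hα, rfl⟩)
    have h2 := hfu' (β, v) ⟨rfl, le_refl v⟩
    rw [hfd, hf0] at h1 h2
    nlinarith
  have hev : ∀ᶠ η in 𝓝[>] (0:ℝ), ∀ α ∈ S, y0 ⬝ᵥ α - y0 ⬝ᵥ β + (h α - v) * (τ - η) < 0 := by
    rw [Filter.eventually_all_finset]
    intro α hα
    apply eventually_nhdsWithin_of_eventually_nhds
    have hcont : Continuous fun η : ℝ => y0 ⬝ᵥ α - y0 ⬝ᵥ β + (h α - v) * (τ - η) := by fun_prop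
    exact hcont.continuousAt.eventually_lt continuousAt_const (by simpa using hstr α hα)
  obtain ⟨η, hη, hη0⟩ := (hev.and self_mem_nhdsWithin).exists
  have hpos : 0 < η - τ := by have h0 : 0 < η := hη0; linarith
  refine ⟨(η - τ)⁻¹ • y0, fun α hα => ?_⟩
  rw [smul_dotProduct, smul_dotProduct, smul_eq_mul, smul_eq_mul, ← mul_sub, inv_mul_le_iff₀ hpos]
  have := hη α hα
  nlinarith

theorem dot_sum {n : ℕ} (y : Fin n → ℝ) (A : Finset (Fin n → ℝ)) (l : (Fin n → ℝ) → ℝ) :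
    y ⬝ᵥ (∑ a ∈ A, l a • a) = ∑ a ∈ A, l a * (y ⬝ᵥ a) := by
  rw [dotProduct_sum]
  simp [dotProduct_smul]

theorem exists_slope {n : ℕ} (𝒜 : Finset (Fin n → ℝ)) (β : Fin n → ℝ) (h : (Fin n → ℝ) → ℝ)
    (hc : ∀ A ⊆ 𝒜, ∀ γ ∈ insert β 𝒜, ∀ l : (Fin n → ℝ) → ℝ, IsRedCircuit n 𝒜 A γ →
      (∀ a ∈ A, 0 < l a) → ∑ a ∈ A, l a = 1 → ∑ a ∈ A, l a • a = γ →
      h γ ≤ ∑ a ∈ A, l a * h a) (ε : ℝ) (hε : 0 < ε) :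
    ∃ y : Fin n → ℝ, ∀ α ∈ 𝒜.erase β, y ⬝ᵥ α - y ⬝ᵥ β ≤ h α - (h β - ε) := by
  by_contra hno
  set S := 𝒜.erase β with hS
  set C := convexHull ℝ ((fun α => (α, h α)) '' (S : Set (Fin n → ℝ))) with hC
  have hCcomp : IsCompact C := (S.finite_toSet.image _).isCompact_convexHull (𝕜 := ℝ)
  have hex : ∃ s ≤ h β - ε, (β, s) ∈ C := by
    by_contra! hcon
    exact hno (sep_lemma S h β _ hcon)
  obtain ⟨s0, hs0, hs0C⟩ := hex
  have hcomp2 : IsCompact (C ∩ {p | p.1 = β}) :=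
    hCcomp.inter_right (isClosed_eq continuous_fst continuous_const)
  obtain ⟨⟨b, s⟩, ⟨hpC, hpb⟩, hpmin⟩ := hcomp2.exists_isMinOn ⟨(β, s0), hs0C, rfl⟩
    (f := Prod.snd) continuous_snd.continuousOn
  simp only [Set.mem_ofPred_eq] at hpb
  subst hpb
  have hss : s < h b := by
    have := hpmin (show (b, s0) ∈ _ from ⟨hs0C, rfl⟩)
    simp only [Set.mem_ofPred_eq] at this
    linarith
  -- weights
  have hw : ∃ l : (Fin n → ℝ) → ℝ, (∀ a ∈ S, 0 ≤ l a) ∧ ∑ a ∈ S, l a = 1 ∧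
      ∑ a ∈ S, l a • a = b ∧ ∑ a ∈ S, l a * h a = s := by
    have hinj : Function.Injective (fun α : Fin n → ℝ => (α, h α)) := fun a b hab => by
      simpa using congrArg Prod.fst hab
    have hpC2 := hpC
    rw [hC, ← Finset.coe_image, Finset.mem_convexHull'] at hpC2
    obtain ⟨w, hw0, hw1, hw2⟩ := hpC2
    rw [Finset.sum_image hinj.injOn] at hw1 hw2
    refine ⟨fun a => w (a, h a), fun a ha => hw0 _ (Finset.mem_image_of_mem _ ha), hw1, ?_, ?_⟩
    · have := congrArg Prod.fst hw2
      simpa [Prod.fst_sum] using this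
    · have := congrArg Prod.snd hw2
      simpa [Prod.snd_sum] using this
  obtain ⟨l, hl0, hl1, hlb, hls⟩ := hw
  set T := S.filter fun a => 0 < l a with hT
  have hTne : T.Nonempty := by
    by_contra hcon
    rw [Finset.not_nonempty_iff_eq_empty, hT, Finset.filter_eq_empty_iff] at hcon
    have : ∑ a ∈ S, l a = 0 := Finset.sum_eq_zero fun a ha => le_antisymm (not_lt.1 (hcon ha)) (hl0 a ha)
    linarith
  have hTsum : ∀ {M : Type} [AddCommMonoid M] (F : (Fin n → ℝ) → M), (∀ a, l a = 0 → F a = 0) →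
      ∑ a ∈ T, F a = ∑ a ∈ S, F a := by
    intro M _ F hF
    rw [hT]
    apply Finset.sum_filter_of_ne
    intro a ha hne
    exact lt_of_le_of_ne (hl0 a ha) fun h => hne (hF a h.symm)
  have hbT : b ∈ convexHull ℝ (T : Set (Fin n → ℝ)) := by
    refine Finset.mem_convexHull'.2 ⟨l, fun a ha => (Finset.mem_filter.1 ha).2.le, ?_, ?_⟩
    · rw [hTsum _ (fun a ha => ha), hl1]
    · rw [hTsum (fun a => l a • a) (fun a ha => by simp only [ha, zero_smul]), hlb]
  obtain ⟨a0, ha0, hamin⟩ := T.exists_min_image l hTne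
  have hla0 : 0 < l a0 := (Finset.mem_filter.1 ha0).2
  set e := l a0 * (h b - s) / 2 with he
  have he0 : 0 < e := by
    rw [he]; have := mul_pos hla0 (sub_pos.2 hss); linarith
  obtain ⟨y, hy⟩ := sep_lemma S h b (s - e) (by
    intro s' hs' hs'C
    have := hpmin (show (b, s') ∈ _ from ⟨hs'C, rfl⟩)
    simp only [Set.mem_ofPred_eq] at this
    linarith)
  have hTA : T ⊆ 𝒜 := fun a ha => Finset.mem_of_mem_erase (Finset.mem_filter.1 ha).1
  obtain ⟨a, haT, hab⟩ := max_principle 𝒜 b (fun x => h x - y ⬝ᵥ x) (by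
    intro A hA γ hγ m hr hm hm1 hmγ
    have := hc A hA γ hγ m hr hm hm1 hmγ
    simp only [mul_sub]
    rw [Finset.sum_sub_distrib, ← dot_sum, hmγ]
    linarith) T hTA hbT
  have haS : a ∈ S := (Finset.mem_filter.1 haT).1
  have hla : 0 < l a := (Finset.mem_filter.1 haT).2
  have hterm : l a * (h a - (s - e) - (y ⬝ᵥ a - y ⬝ᵥ b)) ≤ e := by
    have h1 : l a * (h a - (s - e) - (y ⬝ᵥ a - y ⬝ᵥ b)) ≤
        ∑ x ∈ S, l x * (h x - (s - e) - (y ⬝ᵥ x - y ⬝ᵥ b)) :=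
      Finset.single_le_sum (f := fun x => l x * (h x - (s - e) - (y ⬝ᵥ x - y ⬝ᵥ b)))
        (fun x hx => mul_nonneg (hl0 x hx) (by have := hy x hx; linarith)) haS
    have h2 : ∑ x ∈ S, l x * (h x - (s - e) - (y ⬝ᵥ x - y ⬝ᵥ b)) = e := by
      simp only [mul_sub]
      rw [Finset.sum_sub_distrib, Finset.sum_sub_distrib, Finset.sum_sub_distrib,
        Finset.sum_sub_distrib, ← dot_sum, hlb, hls,
        ← Finset.sum_mul, ← Finset.sum_mul, ← Finset.sum_mul, hl1]
      ring
    linarith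
  have hge : h b - s ≤ h a - (s - e) - (y ⬝ᵥ a - y ⬝ᵥ b) := by linarith
  have hl' : l a0 ≤ l a := hamin a haT
  have h3 : l a0 * (h b - s) ≤ l a * (h a - (s - e) - (y ⬝ᵥ a - y ⬝ᵥ b)) :=
    mul_le_mul hl' hge (sub_pos.2 hss).le hla.le
  linarith

/-- Claim M. -/
theorem pairing {n : ℕ} (𝒜 : Finset (Fin n → ℝ)) (β : Fin n → ℝ) (h : (Fin n → ℝ) → ℝ)
    (hc : ∀ A ⊆ 𝒜, ∀ γ ∈ insert β 𝒜, ∀ l : (Fin n → ℝ) → ℝ, IsRedCircuit n 𝒜 A γ →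
      (∀ a ∈ A, 0 < l a) → ∑ a ∈ A, l a = 1 → ∑ a ∈ A, l a • a = γ →
      h γ ≤ ∑ a ∈ A, l a * h a) (c : (Fin n → ℝ) → ℝ) (δ : ℝ)
    (hcn : ∀ α ∈ 𝒜.erase β, 0 ≤ c α)
    (hf : ∀ y : Fin n → ℝ, δ * Real.exp (y ⬝ᵥ β) ≤ ∑ α ∈ 𝒜.erase β, c α * Real.exp (y ⬝ᵥ α)) :
    δ * Real.exp (h β) ≤ ∑ α ∈ 𝒜.erase β, c α * Real.exp (h α) := by
  have key : ∀ ε > 0, δ * Real.exp (h β - ε) ≤ ∑ α ∈ 𝒜.erase β, c α * Real.exp (h α) := by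
    intro ε hε
    obtain ⟨y, hy⟩ := exists_slope 𝒜 β h hc ε hε
    have h1 := mul_le_mul_of_nonneg_left (hf y) (Real.exp_pos (h β - ε - y ⬝ᵥ β)).le
    have h2 : Real.exp (h β - ε - y ⬝ᵥ β) * (δ * Real.exp (y ⬝ᵥ β)) = δ * Real.exp (h β - ε) := by
      rw [mul_left_comm, ← Real.exp_add]; congr 2; ring
    rw [h2] at h1
    refine h1.trans ?_
    rw [Finset.mul_sum]
    refine Finset.sum_le_sum fun α hα => ?_
    rw [mul_left_comm, ← Real.exp_add]
    refine mul_le_mul_of_nonneg_left (Real.exp_le_exp.2 ?_) (hcn α hα)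
    have := hy α hα
    linarith
  have hlim : Tendsto (fun ε : ℝ => δ * Real.exp (h β - ε)) (𝓝[>] 0) (𝓝 (δ * Real.exp (h β))) := by
    have hcont : Continuous fun ε : ℝ => δ * Real.exp (h β - ε) := by fun_prop
    have := hcont.tendsto 0
    simp only [sub_zero] at this
    exact this.mono_left nhdsWithin_le_nhds
  exact le_of_tendsto hlim (eventually_nhdsWithin_of_forall key)

end SC

namespace SC
open Filter Topology

theorem closed_sum {E : Type*} [NormedAddCommGroup E] [NormedSpace ℝ E] [FiniteDimensional ℝ E]
    {J : Type*} [Fintype J] (P : J → Set E) (hcl : ∀ j, IsClosed (P j))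
    (hsm : ∀ j, ∀ v ∈ P j, ∀ t : ℝ, 0 ≤ t → t • v ∈ P j) (L : E →L[ℝ] ℝ)
    (hpos : ∀ j, ∀ v ∈ P j, v ≠ 0 → 0 < L v) :
    IsClosed {v | ∃ x : J → E, (∀ j, x j ∈ P j) ∧ v = ∑ j, x j} := by
  have : ProperSpace E := FiniteDimensional.proper ℝ E
  have hC : ∀ j, ∃ C : ℝ, 0 ≤ C ∧ ∀ v ∈ P j, ‖v‖ ≤ C * L v := by
    intro j
    have hcomp : IsCompact (P j ∩ Metric.sphere (0 : E) 1) :=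
      (isCompact_sphere (0 : E) 1).inter_left (hcl j)
    have hunit : ∀ v ∈ P j, v ≠ 0 → ‖v‖⁻¹ • v ∈ P j ∩ Metric.sphere (0 : E) 1 := by
      intro v hv hv0
      refine ⟨hsm j v hv _ (by positivity), ?_⟩
      rw [mem_sphere_zero_iff_norm, norm_smul, norm_inv, norm_norm,
        inv_mul_cancel₀ (norm_ne_zero_iff.2 hv0)]
    rcases (P j ∩ Metric.sphere (0 : E) 1).eq_empty_or_nonempty with hem | hne
    · refine ⟨0, le_refl _, fun v hv => ?_⟩
      by_cases hv0 : v = 0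
      · simp [hv0]
      · have := hunit v hv hv0
        rw [hem] at this
        exact this.elim
    · obtain ⟨z, hz, hzmin⟩ := hcomp.exists_isMinOn hne L.continuous.continuousOn
      have hz0 : z ≠ 0 := by
        rintro rfl
        have := hz.2
        simp at this
      have hLz := hpos j z hz.1 hz0
      refine ⟨(L z)⁻¹, by positivity, fun v hv => ?_⟩
      by_cases hv0 : v = 0
      · simp [hv0]
      · have h1 : L z ≤ L (‖v‖⁻¹ • v) := hzmin (hunit v hv hv0)
        rw [map_smul, smul_eq_mul] at h1
        have hn : 0 < ‖v‖ := norm_pos_iff.2 hv0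
        rw [le_inv_mul_iff₀ hn] at h1
        rw [le_inv_mul_iff₀ hLz]
        linarith
  choose C hC0 hCv using hC
  have hLnn : ∀ j, ∀ v ∈ P j, 0 ≤ L v := by
    intro j v hv
    by_cases h0 : v = 0
    · simp [h0]
    · exact (hpos j v hv h0).le
  set K := {v | ∃ x : J → E, (∀ j, x j ∈ P j) ∧ v = ∑ j, x j} with hK
  refine isClosed_of_closure_subset fun y hy => ?_
  set R := ‖L‖ * (‖y‖ + 1) with hR
  set Z : Set (J → E) := Set.pi Set.univ fun j => P j ∩ Metric.closedBall (0 : E) (C j * R) with hZ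
  have hZc : IsCompact Z :=
    isCompact_univ_pi fun j => (isCompact_closedBall (0 : E) _).inter_left (hcl j)
  have hcont : Continuous fun x : J → E => ∑ j, x j := by fun_prop
  have himc : IsClosed ((fun x : J → E => ∑ j, x j) '' Z) := (hZc.image hcont).isClosed
  have hsub : K ∩ Metric.ball y 1 ⊆ (fun x : J → E => ∑ j, x j) '' Z := by
    rintro v ⟨⟨x, hx, rfl⟩, hv⟩
    refine ⟨x, fun j _ => ⟨hx j, ?_⟩, rfl⟩
    rw [mem_closedBall_zero_iff]
    refine (hCv j _ (hx j)).trans (mul_le_mul_of_nonneg_left ?_ (hC0 j))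
    have h1 : L (x j) ≤ L (∑ j, x j) := by
      rw [map_sum]
      exact Finset.single_le_sum (f := fun j => L (x j)) (fun i _ => hLnn i _ (hx i)) (Finset.mem_univ j)
    have h2 : L (∑ j, x j) ≤ ‖L‖ * ‖∑ j, x j‖ := (le_abs_self _).trans (L.le_opNorm _)
    have h3 : ‖∑ j, x j‖ ≤ ‖y‖ + 1 := by
      have h4 := mem_ball_iff_norm.1 hv
      have h5 := norm_add_le (∑ j, x j - y) y
      rw [sub_add_cancel] at h5
      linarith
    exact h1.trans (h2.trans (mul_le_mul_of_nonneg_left h3 (norm_nonneg _)))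
  have hy2 : y ∈ closure (K ∩ Metric.ball y 1) := by
    rw [mem_closure_iff_nhds] at hy ⊢
    intro U hU
    obtain ⟨z, hz1, hz2⟩ := hy (U ∩ Metric.ball y 1)
      (Filter.inter_mem hU (Metric.ball_mem_nhds y one_pos))
    exact ⟨z, hz1.1, hz2, hz1.2⟩
  have hy3 := closure_minimal hsub himc hy2
  obtain ⟨x, hx, rfl⟩ := hy3
  exact ⟨x, fun j => (hx j trivial).1, rfl⟩

/-- Separation from a closed convex cone, in coordinates. -/
theorem cone_sep {ι : Type*} [Fintype ι] (K : Set (ι → ℝ)) (hcl : IsClosed K)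
    (h0 : (0 : ι → ℝ) ∈ K)
    (hadd : ∀ a ∈ K, ∀ b ∈ K, a + b ∈ K) (hsm : ∀ a ∈ K, ∀ t : ℝ, 0 ≤ t → t • a ∈ K)
    (v : ι → ℝ) (hv : v ∉ K) :
    ∃ w : ι → ℝ, (∀ k ∈ K, 0 ≤ ∑ i, w i * k i) ∧ ∑ i, w i * v i < 0 := by
  have hconv : Convex ℝ K := by
    intro a ha b hb s t hs ht _
    exact hadd _ (hsm a ha s hs) _ (hsm b hb t ht)
  obtain ⟨f, u, hu, huv⟩ := geometric_hahn_banach_closed_point hconv hcl hv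
  have hu0 : 0 < u := by simpa using hu 0 h0
  have hrep : ∀ x : ι → ℝ, ∑ i, (-f (Pi.single i 1)) * x i = - f x := by
    intro x
    have h2 := LinearMap.pi_apply_eq_sum_univ (f : (ι → ℝ) →ₗ[ℝ] ℝ) x
    simp only [ContinuousLinearMap.coe_coe] at h2
    rw [h2, ← Finset.sum_neg_distrib]
    refine Finset.sum_congr rfl fun i _ => ?_
    have : (fun j => if i = j then (1:ℝ) else 0) = Pi.single i 1 := by
      ext j; simp [Pi.single_apply, eq_comm]
    rw [this, smul_eq_mul]; ring
  refine ⟨fun i => -f (Pi.single i 1), fun k hk => ?_, ?_⟩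
  · rw [hrep]
    by_contra! hneg
    have hfk : 0 < f k := by linarith
    have := hu _ (hsm k hk (u / f k) (by positivity))
    rw [map_smul, smul_eq_mul, div_mul_cancel₀ _ hfk.ne'] at this
    linarith
  · rw [hrep]; linarith

theorem mon_abs {n : ℕ} (x : Fin n → ℝ) (hx : ∀ i, x i ≠ 0) (α : Fin n → ℝ) :
    ∏ i, |x i| ^ (α i) = Real.exp ((fun i => Real.log |x i|) ⬝ᵥ α) := by
  rw [dotProduct, Real.exp_sum]
  refine Finset.prod_congr rfl fun i _ => ?_
  rw [Real.rpow_def_of_pos (abs_pos.2 (hx i))]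

theorem mon_exp {n : ℕ} (y : Fin n → ℝ) (α : Fin n → ℝ) :
    ∏ i, |Real.exp (y i)| ^ (α i) = Real.exp (y ⬝ᵥ α) := by
  rw [mon_abs _ (fun i => (Real.exp_pos _).ne')]
  simp [Real.abs_exp]

theorem mon_odd_abs {n : ℕ} (x : Fin n → ℝ) (hx : ∀ i, x i ≠ 0) (β : Fin n → ℕ) :
    |∏ i, (x i) ^ (β i)| = Real.exp ((fun i => Real.log |x i|) ⬝ᵥ natEmb n β) := by
  rw [← mon_abs x hx, Finset.abs_prod]
  refine Finset.prod_congr rfl fun i _ => ?_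
  rw [abs_pow, natEmb, Real.rpow_natCast]

theorem mon_odd_exp {n : ℕ} (y : Fin n → ℝ) (β : Fin n → ℕ) :
    ∏ i, (Real.exp (y i)) ^ (β i) = Real.exp (y ⬝ᵥ natEmb n β) := by
  rw [← mon_exp]
  refine Finset.prod_congr rfl fun i _ => ?_
  rw [natEmb, Real.rpow_natCast, Real.abs_exp]

/-- Sign flip. -/
theorem exists_flip {n : ℕ} (β : Fin n → ℕ) (hβ : ∃ i, Odd (β i)) (y : Fin n → ℝ) :
    ∃ x : Fin n → ℝ, (∀ i, x i ≠ 0) ∧ (∀ α : Fin n → ℝ, ∏ i, |x i| ^ (α i) = Real.exp (y ⬝ᵥ α)) ∧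
      ∏ i, (x i) ^ (β i) = - Real.exp (y ⬝ᵥ natEmb n β) := by
  obtain ⟨i0, hi0⟩ := hβ
  refine ⟨fun i => (if i = i0 then -1 else 1) * Real.exp (y i), ?_, ?_, ?_⟩
  · intro i
    have := (Real.exp_pos (y i)).ne'
    dsimp only
    split_ifs <;> simp [this]
  · intro α
    rw [← mon_exp]
    refine Finset.prod_congr rfl fun i _ => ?_
    congr 1
    dsimp only
    split_ifs <;> simp
  · simp only [mul_pow]
    rw [Finset.prod_mul_distrib, mon_odd_exp]
    have : ∏ i, (if i = i0 then (-1:ℝ) else 1) ^ (β i) = -1 := by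
      rw [Finset.prod_eq_single i0]
      · simp [hi0.neg_one_pow]
      · intro b _ hb; simp [hb]
      · simp
    rw [this]; ring

theorem jensen {n : ℕ} (A : Finset (Fin n → ℝ)) (l h : (Fin n → ℝ) → ℝ) (γ : Fin n → ℝ)
    (hl : ∀ a ∈ A, 0 < l a) (hl1 : ∑ a ∈ A, l a = 1) (hlγ : ∑ a ∈ A, l a • a = γ)
    (y : Fin n → ℝ) :
    Real.exp (-∑ a ∈ A, l a * h a) * Real.exp (y ⬝ᵥ γ) ≤
      ∑ a ∈ A, (l a * Real.exp (- h a)) * Real.exp (y ⬝ᵥ a) := by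
  have := convexOn_exp.map_sum_le (t := A) (w := l) (p := fun a => y ⬝ᵥ a - h a)
    (fun a ha => (hl a ha).le) hl1 (fun _ _ => Set.mem_univ _)
  simp only [smul_eq_mul, mul_sub] at this
  rw [Finset.sum_sub_distrib, ← dot_sum, hlγ] at this
  rw [← Real.exp_add, neg_add_eq_sub]
  refine this.trans (le_of_eq (Finset.sum_congr rfl fun a _ => ?_))
  rw [mul_assoc, ← Real.exp_add, neg_add_eq_sub]

end SC

namespace SC
open Filter Topology

section
variable {n : ℕ} (𝒜 : Finset (Fin n → ℝ)) (B : Finset (Fin n → ℕ))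

/-- Coefficient space. -/
abbrev V := (𝒜 ⊕ B) → ℝ

def mk (c : (Fin n → ℝ) → ℝ) (d : (Fin n → ℕ) → ℝ) : V 𝒜 B :=
  Sum.elim (fun a => c a.1) (fun b => d b.1)

variable {𝒜 B}

def cA (v : V 𝒜 B) (α : Fin n → ℝ) : ℝ := if h : α ∈ 𝒜 then v (Sum.inl ⟨α, h⟩) else 0
def dB (v : V 𝒜 B) (β : Fin n → ℕ) : ℝ := if h : β ∈ B then v (Sum.inr ⟨β, h⟩) else 0

theorem cA_of_mem (v : V 𝒜 B) {α} (h : α ∈ 𝒜) : cA v α = v (Sum.inl ⟨α, h⟩) := dif_pos h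
theorem dB_of_mem (v : V 𝒜 B) {β} (h : β ∈ B) : dB v β = v (Sum.inr ⟨β, h⟩) := dif_pos h

theorem cA_mk (c d) {α} (h : α ∈ 𝒜) : cA (mk 𝒜 B c d) α = c α := by
  rw [cA_of_mem _ h]; rfl
theorem dB_mk (c d) {β} (h : β ∈ B) : dB (mk 𝒜 B c d) β = d β := by
  rw [dB_of_mem _ h]; rfl
theorem mk_self (v : V 𝒜 B) : mk 𝒜 B (cA v) (dB v) = v := by
  ext i
  rcases i with a | b
  · exact cA_of_mem v a.2
  · exact dB_of_mem v b.2

theorem mk_ext {c c' : (Fin n → ℝ) → ℝ} {d d' : (Fin n → ℕ) → ℝ} (h1 : ∀ α ∈ 𝒜, c α = c' α)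
    (h2 : ∀ β ∈ B, d β = d' β) : mk 𝒜 B c d = mk 𝒜 B c' d' := by
  ext i
  rcases i with a | b
  · exact h1 a.1 a.2
  · exact h2 b.1 b.2

def F (v : V 𝒜 B) (x : Fin n → ℝ) : ℝ :=
  ∑ α ∈ 𝒜, cA v α * ∏ i, |x i| ^ (α i) + ∑ β ∈ B, dB v β * ∏ i, (x i) ^ (β i)

theorem F_mk (c d) (x : Fin n → ℝ) : F (mk 𝒜 B c d) x =
    ∑ α ∈ 𝒜, c α * ∏ i, |x i| ^ (α i) + ∑ β ∈ B, d β * ∏ i, (x i) ^ (β i) := by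
  unfold F
  congr 1
  · exact Finset.sum_congr rfl fun α h => by rw [cA_mk _ _ h]
  · exact Finset.sum_congr rfl fun α h => by rw [dB_mk _ _ h]

theorem sum_mk (p q c d) : ∑ i, mk 𝒜 B p q i * mk 𝒜 B c d i =
    ∑ α ∈ 𝒜, p α * c α + ∑ β ∈ B, q β * d β := by
  rw [Fintype.sum_sum_type]
  simp only [mk, Sum.elim_inl, Sum.elim_inr]
  rw [Finset.sum_coe_sort 𝒜 (fun α => p α * c α), Finset.sum_coe_sort B (fun α => q α * d α)]

theorem cA_cont (α : Fin n → ℝ) : Continuous fun v : V 𝒜 B => cA v α := by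
  unfold cA
  split_ifs
  · exact continuous_apply _
  · exact continuous_const
theorem dB_cont (α : Fin n → ℕ) : Continuous fun v : V 𝒜 B => dB v α := by
  unfold dB
  split_ifs
  · exact continuous_apply _
  · exact continuous_const
theorem cA_add (v w : V 𝒜 B) (α : Fin n → ℝ) : cA (v + w) α = cA v α + cA w α := by
  unfold cA; split_ifs <;> simp
theorem dB_add (v w : V 𝒜 B) (α : Fin n → ℕ) : dB (v + w) α = dB v α + dB w α := by
  unfold dB; split_ifs <;> simp
theorem cA_smul (t : ℝ) (v : V 𝒜 B) (α : Fin n → ℝ) : cA (t • v) α = t * cA v α := by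
  unfold cA; split_ifs <;> simp
theorem dB_smul (t : ℝ) (v : V 𝒜 B) (α : Fin n → ℕ) : dB (t • v) α = t * dB v α := by
  unfold dB; split_ifs <;> simp

theorem F_add (v w : V 𝒜 B) (x) : F (v + w) x = F v x + F w x := by
  unfold F
  simp only [cA_add, dB_add, add_mul, Finset.sum_add_distrib]; ring
theorem F_smul (t : ℝ) (v : V 𝒜 B) (x) : F (t • v) x = t * F v x := by
  unfold F
  simp only [cA_smul, dB_smul, mul_assoc, ← Finset.mul_sum]; ring
theorem F_cont (x : Fin n → ℝ) : Continuous fun v : V 𝒜 B => F v x := by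
  unfold F
  exact (continuous_finsetSum _ fun α _ => (cA_cont α).mul continuous_const).add
    (continuous_finsetSum _ fun α _ => (dB_cont α).mul continuous_const)

/-- Elementary cone: supported on `S`, nonnegative off `N`, nonnegative function. -/
def Pc (S : Set (𝒜 ⊕ B)) (N : 𝒜 ⊕ B) : Set (V 𝒜 B) :=
  {v | (∀ i, i ∉ S → v i = 0) ∧ (∀ i, i ≠ N → 0 ≤ v i) ∧
    ∀ x : Fin n → ℝ, (∀ i, x i ≠ 0) → 0 ≤ F v x}

theorem Pc_closed (S : Set (𝒜 ⊕ B)) (N) : IsClosed (Pc S N) := by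
  have : Pc S N = (⋂ i, ⋂ (_ : i ∉ S), {v : V 𝒜 B | v i = 0}) ∩
      ((⋂ i, ⋂ (_ : i ≠ N), {v : V 𝒜 B | 0 ≤ v i}) ∩
        (⋂ x : Fin n → ℝ, ⋂ (_ : ∀ i, x i ≠ 0), {v : V 𝒜 B | 0 ≤ F v x})) := by
    ext v
    simp only [Pc, Set.mem_inter_iff, Set.mem_iInter, Set.mem_ofPred_eq]
  rw [this]
  refine IsClosed.inter ?_ (IsClosed.inter ?_ ?_)
  · exact isClosed_iInter fun i => isClosed_iInter fun _ =>
      isClosed_eq (continuous_apply i) continuous_const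
  · exact isClosed_iInter fun i => isClosed_iInter fun _ =>
      isClosed_le continuous_const (continuous_apply i)
  · exact isClosed_iInter fun x => isClosed_iInter fun _ =>
      isClosed_le continuous_const (F_cont x)

theorem Pc_smul (S : Set (𝒜 ⊕ B)) (N) (v) (hv : v ∈ Pc S N) (t : ℝ) (ht : 0 ≤ t) :
    t • v ∈ Pc S N := by
  refine ⟨fun i hi => ?_, fun i hi => ?_, fun x hx => ?_⟩
  · simp [hv.1 i hi]
  · exact mul_nonneg ht (hv.2.1 i hi)
  · rw [F_smul]; exact mul_nonneg ht (hv.2.2 x hx)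

theorem Pc_add (S : Set (𝒜 ⊕ B)) (N) (v) (hv : v ∈ Pc S N) (w) (hw : w ∈ Pc S N) :
    v + w ∈ Pc S N := by
  refine ⟨fun i hi => ?_, fun i hi => ?_, fun x hx => ?_⟩
  · simp [hv.1 i hi, hw.1 i hi]
  · exact add_nonneg (hv.2.1 i hi) (hw.2.1 i hi)
  · rw [F_add]; exact add_nonneg (hv.2.2 x hx) (hw.2.2 x hx)

theorem Pc_zero (S : Set (𝒜 ⊕ B)) (N) : (0 : V 𝒜 B) ∈ Pc S N := by
  refine ⟨fun i hi => rfl, fun i hi => le_refl _, fun x hx => ?_⟩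
  have := F_smul (0:ℝ) (0 : V 𝒜 B) x
  rw [zero_smul] at this
  rw [this]; simp

variable (𝒜 B) in
/-- The strictly positive functional. -/
def ell : V 𝒜 B →L[ℝ] ℝ :=
  ∑ a : 𝒜, (Real.exp (a.1 ⬝ᵥ a.1)) • (ContinuousLinearMap.proj (R := ℝ) (φ := fun _ : 𝒜 ⊕ B => ℝ) (Sum.inl a))

theorem ell_apply (v : V 𝒜 B) : ell 𝒜 B v = ∑ α ∈ 𝒜, cA v α * Real.exp (α ⬝ᵥ α) := by
  rw [← Finset.sum_coe_sort]
  simp only [ell, ContinuousLinearMap.sum_apply, ContinuousLinearMap.smul_apply,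
    ContinuousLinearMap.proj_apply, smul_eq_mul]
  refine Finset.sum_congr rfl fun a _ => ?_
  rw [cA_of_mem v a.2, mul_comm]

theorem Pc_pos (hBodd : ∀ β ∈ B, ∃ i, Odd (β i)) (S : Set (𝒜 ⊕ B)) (N)
    (hS : ∀ b, Sum.inr b ∈ S → N = Sum.inr b) (v) (hv : v ∈ Pc S N) (hv0 : v ≠ 0) :
    0 < ell 𝒜 B v := by
  by_contra! hle
  apply hv0
  rw [ell_apply] at hle
  obtain ⟨h1, h2, h3⟩ := hv
  rcases N with ⟨γ, hγ⟩ | ⟨β, hβ⟩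
  · have hinr : ∀ b, v (Sum.inr b) = 0 := fun b => h1 _ fun hb => by simpa using hS b hb
    have hd : ∀ β ∈ B, dB v β = 0 := fun β hβ => by rw [dB_of_mem v hβ, hinr]
    have hc : ∀ α ∈ 𝒜, α ≠ γ → 0 ≤ cA v α := fun α hα hne => by
      rw [cA_of_mem v hα]; exact h2 _ (by simpa using hne)
    have hF := h3 (fun i => Real.exp (((2:ℝ) • γ) i)) (fun i => (Real.exp_pos _).ne')
    unfold F at hF
    rw [Finset.sum_eq_zero (s := B) (fun β hβ => by rw [hd β hβ, zero_mul]), add_zero] at hF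
    simp only [mon_exp] at hF
    have hF2 : 0 ≤ ∑ α ∈ 𝒜, cA v α * Real.exp (((2:ℝ) • γ) ⬝ᵥ α - γ ⬝ᵥ γ) := by
      have := mul_nonneg hF (Real.exp_pos (- (γ ⬝ᵥ γ))).le
      rw [Finset.sum_mul] at this
      refine this.trans (le_of_eq (Finset.sum_congr rfl fun α _ => ?_))
      rw [mul_assoc, ← Real.exp_add, sub_eq_add_neg]
    have hsq : ∀ α : Fin n → ℝ, α ⬝ᵥ α - (((2:ℝ) • γ) ⬝ᵥ α - γ ⬝ᵥ γ) = (α - γ) ⬝ᵥ (α - γ) := by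
      intro α
      simp only [sub_dotProduct, dotProduct_sub, smul_dotProduct, smul_eq_mul]
      rw [dotProduct_comm α γ]; ring
    have hnn : ∀ z : Fin n → ℝ, 0 ≤ z ⬝ᵥ z := fun z => Finset.sum_nonneg fun i _ => mul_self_nonneg _
    have hterm : ∀ α ∈ 𝒜, 0 ≤ cA v α * (Real.exp (α ⬝ᵥ α) - Real.exp (((2:ℝ) • γ) ⬝ᵥ α - γ ⬝ᵥ γ)) := by
      intro α hα
      by_cases hαγ : α = γ
      · have := hsq α
        rw [hαγ] at this ⊢
        rw [sub_self γ, zero_dotProduct, sub_eq_zero] at this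
        rw [← this]; simp
      · refine mul_nonneg (hc α hα hαγ) (sub_nonneg.2 (Real.exp_le_exp.2 ?_))
        have := hsq α
        have := hnn (α - γ)
        linarith
    have hz := (Finset.sum_eq_zero_iff_of_nonneg hterm).1 (le_antisymm (by
      simp only [mul_sub]; rw [Finset.sum_sub_distrib]; linarith) (Finset.sum_nonneg hterm))
    have hcz : ∀ α ∈ 𝒜, α ≠ γ → cA v α = 0 := by
      intro α hα hne
      refine (mul_eq_zero.1 (hz α hα)).resolve_right fun h => hne ?_
      rw [sub_eq_zero, Real.exp_eq_exp] at h
      have h4 := hsq α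
      rw [h, sub_self] at h4
      exact sub_eq_zero.1 (dotProduct_self_eq_zero.1 h4.symm)
    rw [Finset.sum_eq_single γ (fun α hα hne => by rw [hcz α hα hne, zero_mul])
      (fun h => absurd hγ h)] at hF hle
    have hg : cA v γ = 0 := by
      apply le_antisymm
      · by_contra! hp; exact absurd (mul_pos hp (Real.exp_pos (γ ⬝ᵥ γ))) (not_lt.2 hle)
      · by_contra! hp; exact absurd (mul_neg_of_neg_of_pos hp (Real.exp_pos _)) (not_lt.2 hF)
    ext i
    rcases i with ⟨α, hα⟩ | b
    · rw [← cA_of_mem v hα]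
      by_cases h : α = γ
      · exact (congrArg (cA v) h).trans hg
      · exact hcz α hα h
    · exact hinr b
  · have hc : ∀ α ∈ 𝒜, 0 ≤ cA v α := fun α hα => by
      rw [cA_of_mem v hα]; exact h2 _ (by simp)
    have hd : ∀ β' ∈ B, β' ≠ β → dB v β' = 0 := fun β' hβ' hne => by
      rw [dB_of_mem v hβ']
      exact h1 _ fun hb => hne (by simpa using (hS _ hb).symm)
    have hterm : ∀ α ∈ 𝒜, 0 ≤ cA v α * Real.exp (α ⬝ᵥ α) := fun α hα =>
      mul_nonneg (hc α hα) (Real.exp_pos _).le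
    have hz := (Finset.sum_eq_zero_iff_of_nonneg hterm).1 (le_antisymm hle (Finset.sum_nonneg hterm))
    have hcz : ∀ α ∈ 𝒜, cA v α = 0 := fun α hα =>
      (mul_eq_zero.1 (hz α hα)).resolve_right (Real.exp_pos _).ne'
    have hFx : ∀ x : Fin n → ℝ, F v x = dB v β * ∏ i, (x i) ^ (β i) := by
      intro x
      unfold F
      rw [Finset.sum_eq_zero (s := 𝒜) (fun α hα => by rw [hcz α hα, zero_mul]), zero_add]
      exact Finset.sum_eq_single β (fun β' hβ' hne => by rw [hd β' hβ' hne, zero_mul])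
        (fun h => absurd hβ h)
    have hp := h3 (fun i => Real.exp ((0 : Fin n → ℝ) i)) (fun i => (Real.exp_pos _).ne')
    rw [hFx, mon_odd_exp, zero_dotProduct, Real.exp_zero, mul_one] at hp
    obtain ⟨x, hx, -, hxβ⟩ := exists_flip β (hBodd β hβ) 0
    have hm := h3 x hx
    rw [hFx, hxβ, zero_dotProduct, Real.exp_zero] at hm
    have hg : dB v β = 0 := by linarith
    ext i
    rcases i with ⟨α, hα⟩ | ⟨β', hβ'⟩
    · rw [← cA_of_mem v hα]; exact hcz α hα
    · rw [← dB_of_mem v hβ']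
      by_cases h : β' = β
      · exact (congrArg (dB v) h).trans hg
      · exact hd β' hβ' h

end

section
variable {n : ℕ} (𝒜 : Finset (Fin n → ℝ)) (B : Finset (Fin n → ℕ))

abbrev J := 𝒜 ⊕ (evenRed n 𝒜 ⊕ oddRed n 𝒜 B)

variable {𝒜 B}
theorem even_mem {e} (h : e ∈ evenRed n 𝒜) : e.1 ⊆ 𝒜 ∧ e.2 ∈ 𝒜 ∧ IsRedCircuit n 𝒜 e.1 e.2 := by
  simp only [evenRed, Finset.mem_filter, Finset.mem_product, Finset.mem_powerset] at h
  exact ⟨h.1.1, h.1.2, h.2⟩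
theorem odd_mem {e} (h : e ∈ oddRed n 𝒜 B) :
    e.1 ⊆ 𝒜 ∧ e.2 ∈ B ∧ IsRedCircuit n 𝒜 e.1 (natEmb n e.2) := by
  simp only [oddRed, Finset.mem_filter, Finset.mem_product, Finset.mem_powerset] at h
  exact ⟨h.1.1, h.1.2, h.2⟩

def PJ : J 𝒜 B → Set (V 𝒜 B)
  | Sum.inl a => Pc {Sum.inl a} (Sum.inl a)
  | Sum.inr (Sum.inl e) => Pc (Sum.inl '' {a | a.1 ∈ e.1.1 ∨ a.1 = e.1.2})
      (Sum.inl ⟨e.1.2, (even_mem e.2).2.1⟩)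
  | Sum.inr (Sum.inr o) => Pc (Sum.inl '' {a | a.1 ∈ o.1.1} ∪ {Sum.inr ⟨o.1.2, (odd_mem o.2).2.1⟩})
      (Sum.inr ⟨o.1.2, (odd_mem o.2).2.1⟩)

theorem PJ_eq (j : J 𝒜 B) : ∃ S N, PJ j = Pc S N ∧ ∀ b, Sum.inr b ∈ S → N = Sum.inr b := by
  rcases j with a | e | o
  · exact ⟨_, _, rfl, by simp⟩
  · exact ⟨_, _, rfl, by simp⟩
  · exact ⟨_, _, rfl, by simp [eq_comm]⟩

variable (𝒜 B) in
def K : Set (V 𝒜 B) := {v | ∃ x : J 𝒜 B → V 𝒜 B, (∀ j, x j ∈ PJ j) ∧ v = ∑ j, x j}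

theorem K_closed (hBodd : ∀ β ∈ B, ∃ i, Odd (β i)) : IsClosed (K 𝒜 B) := by
  refine closed_sum PJ (fun j => ?_) (fun j => ?_) (ell 𝒜 B) (fun j => ?_)
  all_goals obtain ⟨S, N, h, hS⟩ := PJ_eq j; rw [h]
  · exact Pc_closed S N
  · exact Pc_smul S N
  · exact Pc_pos hBodd S N hS

theorem K_smul (v) (hv : v ∈ K 𝒜 B) (t : ℝ) (ht : 0 ≤ t) : t • v ∈ K 𝒜 B := by
  obtain ⟨x, hx, rfl⟩ := hv
  refine ⟨fun j => t • x j, fun j => ?_, by rw [Finset.smul_sum]⟩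
  have := hx j
  obtain ⟨S, N, h, -⟩ := PJ_eq j
  rw [h] at this ⊢
  exact Pc_smul S N _ this t ht

theorem K_add (v) (hv : v ∈ K 𝒜 B) (w) (hw : w ∈ K 𝒜 B) : v + w ∈ K 𝒜 B := by
  obtain ⟨x, hx, rfl⟩ := hv
  obtain ⟨y, hy, rfl⟩ := hw
  refine ⟨fun j => x j + y j, fun j => ?_, by rw [Finset.sum_add_distrib]⟩
  have h1 := hx j
  have h2 := hy j
  obtain ⟨S, N, h, -⟩ := PJ_eq j
  rw [h] at h1 h2 ⊢
  exact Pc_add S N _ h1 _ h2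

theorem PJ_zero (j : J 𝒜 B) : (0 : V 𝒜 B) ∈ PJ j := by
  obtain ⟨S, N, h, -⟩ := PJ_eq j
  rw [h]; exact Pc_zero S N

theorem K_zero : (0 : V 𝒜 B) ∈ K 𝒜 B := ⟨fun _ => 0, PJ_zero, by simp⟩

theorem K_of_PJ (j : J 𝒜 B) (v) (hv : v ∈ PJ j) : v ∈ K 𝒜 B := by
  refine ⟨fun i => if i = j then v else 0, fun i => ?_, by simp⟩
  dsimp only
  split_ifs with h
  · rw [h]; exact hv
  · exact PJ_zero i

theorem K_sep (hBodd : ∀ β ∈ B, ∃ i, Odd (β i)) (c : (Fin n → ℝ) → ℝ) (d : (Fin n → ℕ) → ℝ)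
    (h : mk 𝒜 B c d ∉ K 𝒜 B) :
    ∃ (p : (Fin n → ℝ) → ℝ) (q : (Fin n → ℕ) → ℝ),
      (∀ c' d', mk 𝒜 B c' d' ∈ K 𝒜 B → 0 ≤ ∑ α ∈ 𝒜, p α * c' α + ∑ β ∈ B, q β * d' β) ∧
      ∑ α ∈ 𝒜, p α * c α + ∑ β ∈ B, q β * d β < 0 := by
  obtain ⟨w, hw1, hw2⟩ := cone_sep _ (K_closed hBodd) K_zero K_add K_smul _ h
  refine ⟨cA w, dB w, fun c' d' h' => ?_, ?_⟩
  · rw [← sum_mk, mk_self]; exact hw1 _ h'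
  · rw [← sum_mk, mk_self]; exact hw2

end
end SC

namespace SC
open Filter Topology

section
variable {n : ℕ} {𝒜 : Finset (Fin n → ℝ)} {B : Finset (Fin n → ℕ)}

theorem K_ray (a) (ha : a ∈ 𝒜) : mk 𝒜 B (fun α => if α = a then 1 else 0) (fun _ => 0) ∈ K 𝒜 B := by
  refine K_of_PJ (Sum.inl ⟨a, ha⟩) _ ⟨?_, ?_, ?_⟩
  · rintro (⟨α, hα⟩ | b) hi
    · have : α ≠ a := by simpa using hi
      simp [mk, this]
    · rfl
  · rintro (⟨α, hα⟩ | b) hi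
    · simp only [mk, Sum.elim_inl]; split_ifs <;> norm_num
    · exact le_refl _
  · intro x hx
    rw [F_mk]
    simp only [zero_mul, Finset.sum_const_zero, add_zero]
    refine Finset.sum_nonneg fun α _ => mul_nonneg (by split_ifs <;> norm_num) ?_
    rw [mon_abs x hx]; exact (Real.exp_pos _).le

theorem K_even {e} (he : e ∈ evenRed n 𝒜) (c : (Fin n → ℝ) → ℝ)
    (h1 : ∀ α ∈ 𝒜, α ∉ e.1 → α ≠ e.2 → c α = 0) (h2 : ∀ α ∈ 𝒜, α ≠ e.2 → 0 ≤ c α)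
    (h3 : ∀ y : Fin n → ℝ, 0 ≤ ∑ α ∈ 𝒜, c α * Real.exp (y ⬝ᵥ α)) :
    mk 𝒜 B c (fun _ => 0) ∈ K 𝒜 B := by
  refine K_of_PJ (Sum.inr (Sum.inl ⟨e, he⟩)) _ ⟨?_, ?_, ?_⟩
  · rintro (⟨α, hα⟩ | b) hi
    · have : α ∉ e.1 ∧ α ≠ e.2 := by simpa [hα] using hi
      exact h1 α hα this.1 this.2
    · rfl
  · rintro (⟨α, hα⟩ | b) hi
    · exact h2 α hα (by simpa using hi)
    · exact le_refl _
  · intro x hx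
    rw [F_mk]
    simp only [zero_mul, Finset.sum_const_zero, add_zero, mon_abs x hx]
    exact h3 _

theorem K_odd {e} (he : e ∈ oddRed n 𝒜 B) (c : (Fin n → ℝ) → ℝ) (r : ℝ)
    (h1 : ∀ α ∈ 𝒜, α ∉ e.1 → c α = 0) (h2 : ∀ α ∈ 𝒜, 0 ≤ c α)
    (h3 : ∀ y : Fin n → ℝ, |r| * Real.exp (y ⬝ᵥ natEmb n e.2) ≤ ∑ α ∈ 𝒜, c α * Real.exp (y ⬝ᵥ α)) :
    mk 𝒜 B c (fun β => if β = e.2 then r else 0) ∈ K 𝒜 B := by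
  refine K_of_PJ (Sum.inr (Sum.inr ⟨e, he⟩)) _ ⟨?_, ?_, ?_⟩
  · rintro (⟨α, hα⟩ | ⟨β, hβ⟩) hi
    · have : α ∉ e.1 := by simpa [hα] using hi
      exact h1 α hα this
    · have : β ≠ e.2 := by simpa using hi
      simp [mk, this]
  · rintro (⟨α, hα⟩ | ⟨β, hβ⟩) hi
    · exact h2 α hα
    · have : β ≠ e.2 := by simpa using hi
      simp [mk, this]
  · intro x hx
    rw [F_mk]
    simp only [mon_abs x hx, ite_mul, zero_mul]
    rw [Finset.sum_ite_eq' B e.2, if_pos (odd_mem he).2.1]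
    have := h3 (fun i => Real.log |x i|)
    rw [← mon_odd_abs x hx, ← abs_mul] at this
    linarith [neg_abs_le (r * ∏ i, x i ^ e.2 i)]

theorem sum_sub (A : Finset (Fin n → ℝ)) (hA : A ⊆ 𝒜) (m g : (Fin n → ℝ) → ℝ) :
    ∑ α ∈ 𝒜, (if α ∈ A then m α else 0) * g α = ∑ α ∈ A, m α * g α := by
  simp only [ite_mul, zero_mul]
  rw [Finset.sum_ite_mem, Finset.inter_eq_right.2 hA]

theorem circ_even (p : (Fin n → ℝ) → ℝ) (q : (Fin n → ℕ) → ℝ) (hK : ∀ c' d', mk 𝒜 B c' d' ∈ K 𝒜 B →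
      0 ≤ ∑ α ∈ 𝒜, p α * c' α + ∑ β ∈ B, q β * d' β) (ε : ℝ) (hε : 0 < ε)
    (h : (Fin n → ℝ) → ℝ) (hh : ∀ α ∈ 𝒜, Real.exp (h α) = p α + ε)
    (A : Finset (Fin n → ℝ)) (hA : A ⊆ 𝒜) (γ) (hγ : γ ∈ 𝒜) (l : (Fin n → ℝ) → ℝ)
    (hR : IsRedCircuit n 𝒜 A γ) (hl : ∀ a ∈ A, 0 < l a) (hl1 : ∑ a ∈ A, l a = 1)
    (hlγ : ∑ a ∈ A, l a • a = γ) : h γ ≤ ∑ a ∈ A, l a * h a := by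
  set E := Real.exp (-∑ a ∈ A, l a * h a) with hE
  have hEpos : 0 < E := Real.exp_pos _
  have hj := jensen A l h γ hl hl1 hlγ
  have hsum : ∀ g : (Fin n → ℝ) → ℝ, ∑ α ∈ 𝒜, ((if α = γ then -E else 0) +
      (if α ∈ A then l α * Real.exp (-h α) else 0)) * g α =
      -E * g γ + ∑ α ∈ A, (l α * Real.exp (-h α)) * g α := by
    intro g
    simp only [add_mul]
    rw [Finset.sum_add_distrib, sum_sub A hA]
    simp [hγ]
  have hmem : mk 𝒜 B (fun α => (if α = γ then -E else 0) +
      (if α ∈ A then l α * Real.exp (-h α) else 0)) (fun _ => 0) ∈ K 𝒜 B := by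
    refine K_even (e := (A, γ)) ?_ _ ?_ ?_ ?_
    · simp only [evenRed, Finset.mem_filter, Finset.mem_product, Finset.mem_powerset]
      exact ⟨⟨hA, hγ⟩, hR⟩
    · intro α _ h1 h2
      simp only [] at h1 h2
      simp [h1, h2]
    · intro α _ h2
      simp only [] at h2
      simp only [h2, if_false, zero_add]
      split_ifs with h3
      · exact mul_nonneg (hl α h3).le (Real.exp_pos _).le
      · exact le_refl _
    · intro y
      rw [hsum]
      have := hj y
      linarith
  have h1 := hK _ _ hmem
  simp only [mul_zero, Finset.sum_const_zero, add_zero] at h1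
  simp only [mul_comm (p _)] at h1
  rw [hsum] at h1
  have h2 := hj 0
  simp only [zero_dotProduct, Real.exp_zero, mul_one] at h2
  have h3 : ∑ α ∈ A, (l α * Real.exp (-h α)) * p α =
      1 - ε * ∑ α ∈ A, (l α * Real.exp (-h α)) := by
    rw [← hl1, Finset.mul_sum, ← Finset.sum_sub_distrib]
    refine Finset.sum_congr rfl fun a ha => ?_
    have : p a = Real.exp (h a) - ε := by rw [hh a (hA ha)]; ring
    rw [this, mul_sub, mul_assoc, ← Real.exp_add, neg_add_cancel, Real.exp_zero]; ring
  have h4 : p γ = Real.exp (h γ) - ε := by rw [hh γ hγ]; ring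
  rw [h3, h4] at h1
  have h5 : E * Real.exp (h γ) ≤ 1 := by nlinarith
  rw [hE, ← Real.exp_add, Real.exp_le_one_iff] at h5
  linarith

theorem circ_odd (p : (Fin n → ℝ) → ℝ) (q : (Fin n → ℕ) → ℝ) (hK : ∀ c' d', mk 𝒜 B c' d' ∈ K 𝒜 B →
      0 ≤ ∑ α ∈ 𝒜, p α * c' α + ∑ β ∈ B, q β * d' β) (ε : ℝ) (hε : 0 < ε)
    (h : (Fin n → ℝ) → ℝ) (hh : ∀ α ∈ 𝒜, Real.exp (h α) = p α + ε)
    (A : Finset (Fin n → ℝ)) (hA : A ⊆ 𝒜) (β) (hβ : β ∈ B) (hhβ : Real.exp (h (natEmb n β)) = |q β|)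
    (l : (Fin n → ℝ) → ℝ)
    (hR : IsRedCircuit n 𝒜 A (natEmb n β)) (hl : ∀ a ∈ A, 0 < l a) (hl1 : ∑ a ∈ A, l a = 1)
    (hlγ : ∑ a ∈ A, l a • a = natEmb n β) : h (natEmb n β) ≤ ∑ a ∈ A, l a * h a := by
  set E := Real.exp (-∑ a ∈ A, l a * h a) with hE
  have hEpos : 0 < E := Real.exp_pos _
  have hj := jensen A l h _ hl hl1 hlγ
  have hmem : ∀ r : ℝ, |r| = E → mk 𝒜 B (fun α =>
      (if α ∈ A then l α * Real.exp (-h α) else 0)) (fun β' => if β' = β then r else 0) ∈ K 𝒜 B := by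
    intro r hr
    refine K_odd (e := (A, β)) ?_ _ _ ?_ ?_ ?_
    · simp only [oddRed, Finset.mem_filter, Finset.mem_product, Finset.mem_powerset]
      exact ⟨⟨hA, hβ⟩, hR⟩
    · intro α _ h1
      exact if_neg h1
    · intro α _
      split_ifs with h3
      · exact mul_nonneg (hl α h3).le (Real.exp_pos _).le
      · exact le_refl _
    · intro y
      rw [sum_sub A hA, hr]
      exact hj y
  have key : ∀ r : ℝ, |r| = E → 0 ≤ ∑ α ∈ A, (l α * Real.exp (-h α)) * p α + q β * r := by
    intro r hr
    have h1 := hK _ _ (hmem r hr)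
    simp only [mul_comm (p _)] at h1
    rw [sum_sub A hA] at h1
    simpa [hβ] using h1
  have h3 : ∑ α ∈ A, (l α * Real.exp (-h α)) * p α ≤ 1 := by
    rw [← hl1]
    refine Finset.sum_le_sum fun a ha => ?_
    have : p a = Real.exp (h a) - ε := by rw [hh a (hA ha)]; ring
    rw [this, mul_sub, mul_assoc, ← Real.exp_add, neg_add_cancel, Real.exp_zero]
    have := mul_pos (mul_pos (hl a ha) (Real.exp_pos (-h a))) hε
    linarith
  have h5 : E * Real.exp (h (natEmb n β)) ≤ 1 := by
    rw [hhβ]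
    have k1 := key E (abs_of_pos hEpos)
    have k2 := key (-E) (by rw [abs_neg, abs_of_pos hEpos])
    rcases abs_cases (q β) with ⟨h, _⟩ | ⟨h, _⟩ <;> rw [h] <;> nlinarith
  rw [hE, ← Real.exp_add, Real.exp_le_one_iff] at h5
  linarith

theorem p_nonneg (p : (Fin n → ℝ) → ℝ) (q : (Fin n → ℕ) → ℝ) (hK : ∀ c' d', mk 𝒜 B c' d' ∈ K 𝒜 B →
      0 ≤ ∑ α ∈ 𝒜, p α * c' α + ∑ β ∈ B, q β * d' β) (α) (hα : α ∈ 𝒜) : 0 ≤ p α := by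
  have := hK _ _ (K_ray α hα)
  simpa [hα] using this

theorem eps_lim (a b : ℝ) (h : ∀ ε : ℝ, 0 < ε → 0 ≤ a + ε * b) : 0 ≤ a := by
  by_contra! ha
  have h1 := h (-a / (2 * (|b| + 1))) (by have := abs_nonneg b; apply div_pos <;> linarith)
  have hb : (-a / (2 * (|b| + 1))) * b ≤ -a / 2 := by
    have h0 := abs_nonneg b
    rw [div_mul_eq_mul_div, div_le_div_iff₀ (by linarith) (by norm_num)]
    nlinarith [le_abs_self b]
  linarith

theorem gen_even (hBodd : ∀ β ∈ B, ∃ i, Odd (β i)) (c : (Fin n → ℝ) → ℝ) (d : (Fin n → ℕ) → ℝ)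
    (γ) (hγ : γ ∈ 𝒜) (hc : ∀ α ∈ 𝒜, α ≠ γ → 0 ≤ c α) (hd : ∀ β ∈ B, d β = 0)
    (hF : ∀ x : Fin n → ℝ, (∀ i, x i ≠ 0) → 0 ≤ F (mk 𝒜 B c d) x) : mk 𝒜 B c d ∈ K 𝒜 B := by
  by_contra hn
  obtain ⟨p, q, hK, hlt⟩ := K_sep hBodd c d hn
  rw [Finset.sum_eq_zero (s := B) (fun β hβ => by rw [hd β hβ, mul_zero]), add_zero] at hlt
  refine absurd (eps_lim _ (∑ α ∈ 𝒜, c α) fun ε hε => ?_) (not_le.2 hlt)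
  have hpe : ∀ α ∈ 𝒜, 0 < p α + ε := fun α hα => by
    have := p_nonneg p q hK α hα; linarith
  have hh : ∀ α ∈ 𝒜, Real.exp (Real.log (p α + ε)) = p α + ε := fun α hα => Real.exp_log (hpe α hα)
  have := pairing 𝒜 γ (fun α => Real.log (p α + ε)) (fun A hA γ' hγ' l hR hl hl1 hlγ => by
      rw [Finset.insert_eq_of_mem hγ] at hγ'
      exact circ_even p q hK ε hε _ hh A hA γ' hγ' l hR hl hl1 hlγ) c (-c γ)
    (fun α hα => hc α (Finset.mem_of_mem_erase hα) (Finset.ne_of_mem_erase hα)) (fun y => by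
      have := hF (fun i => Real.exp (y i)) (fun i => (Real.exp_pos _).ne')
      rw [F_mk] at this
      simp only [mon_exp] at this
      rw [Finset.sum_eq_zero (s := B) (fun β hβ => by rw [hd β hβ, zero_mul]), add_zero,
        ← Finset.add_sum_erase _ _ hγ] at this
      linarith)
  rw [hh γ hγ, Finset.sum_congr rfl fun α hα => by rw [hh α (Finset.mem_of_mem_erase hα)]] at this
  rw [Finset.mul_sum, ← Finset.sum_add_distrib, ← Finset.add_sum_erase _ _ hγ]
  have e : ∀ α, p α * c α + ε * c α = c α * (p α + ε) := fun α => by ring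
  simp only [e]
  linarith

theorem gen_odd (hBodd : ∀ β ∈ B, ∃ i, Odd (β i)) (hdisj : ∀ β ∈ B, natEmb n β ∉ 𝒜)
    (c : (Fin n → ℝ) → ℝ) (d : (Fin n → ℕ) → ℝ)
    (β) (hβ : β ∈ B) (hc : ∀ α ∈ 𝒜, 0 ≤ c α) (hd : ∀ β' ∈ B, β' ≠ β → d β' = 0)
    (hF : ∀ x : Fin n → ℝ, (∀ i, x i ≠ 0) → 0 ≤ F (mk 𝒜 B c d) x) : mk 𝒜 B c d ∈ K 𝒜 B := by
  by_contra hn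
  obtain ⟨p, q, hK, hlt⟩ := K_sep hBodd c d hn
  have hp := p_nonneg p q hK
  rw [Finset.sum_eq_single (s := B) β (fun β' hβ' hne => by rw [hd β' hβ' hne, mul_zero])
    (fun h => absurd hβ h)] at hlt
  have hq : 0 ≤ ∑ α ∈ 𝒜, p α * c α := Finset.sum_nonneg fun α hα => mul_nonneg (hp α hα) (hc α hα)
  have hq0 : q β ≠ 0 := by
    intro h; rw [h, zero_mul] at hlt; linarith
  have hni := hdisj β hβ
  have her : 𝒜.erase (natEmb n β) = 𝒜 := Finset.erase_eq_of_notMem hni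
  have hFx : ∀ x : Fin n → ℝ, F (mk 𝒜 B c d) x =
      ∑ α ∈ 𝒜, c α * ∏ i, |x i| ^ (α i) + d β * ∏ i, (x i) ^ (β i) := by
    intro x
    rw [F_mk]
    congr 1
    exact Finset.sum_eq_single β (fun β' hβ' hne => by rw [hd β' hβ' hne, zero_mul])
        (fun h => absurd hβ h)
  have hf : ∀ y : Fin n → ℝ, |d β| * Real.exp (y ⬝ᵥ natEmb n β) ≤
      ∑ α ∈ 𝒜, c α * Real.exp (y ⬝ᵥ α) := by
    intro y
    have h1 := hF (fun i => Real.exp (y i)) (fun i => (Real.exp_pos _).ne')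
    rw [hFx, mon_odd_exp] at h1
    simp only [mon_exp] at h1
    obtain ⟨x, hx, hx1, hx2⟩ := exists_flip β (hBodd β hβ) y
    have h2 := hF x hx
    rw [hFx, hx2] at h2
    simp only [hx1] at h2
    rcases abs_cases (d β) with ⟨h, _⟩ | ⟨h, _⟩ <;> rw [h] <;> linarith
  have main : 0 ≤ ∑ α ∈ 𝒜, p α * c α - |d β| * |q β| := by
    refine eps_lim _ (∑ α ∈ 𝒜, c α) fun ε hε => ?_
    set h : (Fin n → ℝ) → ℝ := fun α => if α = natEmb n β then Real.log |q β| else Real.log (p α + ε)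
      with hdef
    have hpe : ∀ α ∈ 𝒜, 0 < p α + ε := fun α hα => by
      have := hp α hα; linarith
    have hh : ∀ α ∈ 𝒜, Real.exp (h α) = p α + ε := fun α hα => by
      rw [hdef]; dsimp only
      have hne : α ≠ natEmb n β := fun e => hni (e ▸ hα)
      rw [if_neg hne, Real.exp_log (hpe α hα)]
    have hhβ : Real.exp (h (natEmb n β)) = |q β| := by
      rw [hdef]; dsimp only
      rw [if_pos rfl, Real.exp_log (abs_pos.2 hq0)]
    have := pairing 𝒜 (natEmb n β) h (fun A hA γ' hγ' l hR hl hl1 hlγ => by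
        rcases Finset.mem_insert.1 hγ' with h1 | h1
        · subst h1
          exact circ_odd p q hK ε hε _ hh A hA β hβ hhβ l hR hl hl1 hlγ
        · exact circ_even p q hK ε hε _ hh A hA γ' h1 l hR hl hl1 hlγ) c |d β|
      (fun α hα => hc α (Finset.mem_of_mem_erase hα)) (fun y => by rw [her]; exact hf y)
    rw [her, hhβ, Finset.sum_congr rfl fun α hα => by rw [hh α hα]] at this
    simp only [mul_add, Finset.sum_add_distrib] at this
    rw [← Finset.sum_mul] at this
    simp only [mul_comm (p _)]
    linarith
  rw [← abs_mul] at main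
  have := neg_abs_le (d β * q β)
  linarith [mul_comm (d β) (q β)]

theorem AG_mem (h𝒜 : 𝒜.Nonempty) (hBodd : ∀ β ∈ B, ∃ i, Odd (β i)) (hdisj : ∀ β ∈ B, natEmb n β ∉ 𝒜)
    (c d) (h : IsNonnegAG n 𝒜 B c d) : mk 𝒜 B c d ∈ K 𝒜 B := by
  obtain ⟨h1, h2⟩ := h
  have hF : ∀ x : Fin n → ℝ, (∀ i, x i ≠ 0) → 0 ≤ F (mk 𝒜 B c d) x := fun x hx => by
    rw [F_mk]; exact h2 x hx
  obtain ⟨γ0, hγ0⟩ := h𝒜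
  rcases h1 with ⟨hd, hc⟩ | ⟨hc, hd⟩
  · rw [Finset.card_le_one] at hc
    by_cases hn : ∃ γ ∈ 𝒜, c γ < 0
    · obtain ⟨γ, hγ, hneg⟩ := hn
      refine gen_even hBodd c d γ hγ (fun α hα hne => ?_) hd hF
      by_contra! hα2
      exact hne (hc α (by simp [hα, hα2]) γ (by simp [hγ, hneg]))
    · push Not at hn
      exact gen_even hBodd c d γ0 hγ0 (fun α hα _ => hn α hα) hd hF
  · rw [Finset.card_le_one] at hd
    by_cases hn : ∃ β ∈ B, d β ≠ 0
    · obtain ⟨β, hβ, hne0⟩ := hn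
      refine gen_odd hBodd hdisj c d β hβ hc (fun β' hβ' hne => ?_) hF
      by_contra hβ2
      exact hne (hd β' (by simp [hβ', hβ2]) β (by simp [hβ, hne0]))
    · push Not at hn
      exact gen_even hBodd c d γ0 hγ0 (fun α hα _ => hc α hα) hn hF

theorem SCone_mem (h𝒜 : 𝒜.Nonempty) (hBodd : ∀ β ∈ B, ∃ i, Odd (β i))
    (hdisj : ∀ β ∈ B, natEmb n β ∉ 𝒜)
    (c d) (h : InSCone n 𝒜 B c d) : mk 𝒜 B c d ∈ K 𝒜 B := by
  obtain ⟨k, cs, ds, t, h1, h2, h3⟩ := h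
  have : mk 𝒜 B c d = ∑ j, t j • mk 𝒜 B (cs j) (ds j) := by
    ext i
    rw [Finset.sum_apply]
    rcases i with a | b
    · exact h2 a.1 a.2
    · exact h3 b.1 b.2
  rw [this]
  exact Finset.sum_induction _ (· ∈ K 𝒜 B) (fun a b ha hb => K_add a ha b hb) K_zero
    fun j _ => K_smul _ (AG_mem h𝒜 hBodd hdisj _ _ (h1 j).2) _ (h1 j).1

end
end SC

namespace SC
open Filter Topology

section
variable {n : ℕ} {𝒜 : Finset (Fin n → ℝ)} {B : Finset (Fin n → ℕ)}

theorem cA_sum {ι : Type*} (s : Finset ι) (x : ι → V 𝒜 B) (α : Fin n → ℝ) :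
    cA (∑ j ∈ s, x j) α = ∑ j ∈ s, cA (x j) α := by
  unfold cA; split_ifs <;> simp
theorem dB_sum {ι : Type*} (s : Finset ι) (x : ι → V 𝒜 B) (β : Fin n → ℕ) :
    dB (∑ j ∈ s, x j) β = ∑ j ∈ s, dB (x j) β := by
  unfold dB; split_ifs <;> simp

theorem K_split (c d) (h : mk 𝒜 B c d ∈ K 𝒜 B) :
      ∃ (t : (Fin n → ℝ) → ℝ)
        (u : Finset (Fin n → ℝ) × (Fin n → ℝ) → (Fin n → ℝ) → ℝ)
        (w : Finset (Fin n → ℝ) × (Fin n → ℕ) → (Fin n → ℝ) → ℝ)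
        (r : Finset (Fin n → ℝ) × (Fin n → ℕ) → ℝ),
        (∀ α ∈ 𝒜, 0 ≤ t α) ∧
        (∀ Aβ ∈ evenRed n 𝒜, InPeMon n Aβ.1 Aβ.2 (u Aβ)) ∧
        (∀ Aβ ∈ oddRed n 𝒜 B, InPoMon n Aβ.1 Aβ.2 (w Aβ) (r Aβ)) ∧
        (∀ α ∈ 𝒜, c α = t α
          + ∑ Aβ ∈ evenRed n 𝒜, (if α ∈ Aβ.1 ∨ α = Aβ.2 then u Aβ α else 0)
          + ∑ Aβ ∈ oddRed n 𝒜 B, (if α ∈ Aβ.1 then w Aβ α else 0)) ∧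
        (∀ β ∈ B, d β = ∑ Aβ ∈ oddRed n 𝒜 B, (if Aβ.2 = β then r Aβ else 0)) := by
  obtain ⟨x, hx, hsum⟩ := h
  let Xr : (Fin n → ℝ) → V 𝒜 B := fun a => if h : a ∈ 𝒜 then x (Sum.inl ⟨a, h⟩) else 0
  let Xe : Finset (Fin n → ℝ) × (Fin n → ℝ) → V 𝒜 B := fun e =>
    if h : e ∈ evenRed n 𝒜 then x (Sum.inr (Sum.inl ⟨e, h⟩)) else 0
  let Xo : Finset (Fin n → ℝ) × (Fin n → ℕ) → V 𝒜 B := fun e =>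
    if h : e ∈ oddRed n 𝒜 B then x (Sum.inr (Sum.inr ⟨e, h⟩)) else 0
  have hXr : ∀ a (h : a ∈ 𝒜), Xr a = x (Sum.inl ⟨a, h⟩) := fun a h => dif_pos h
  have hXe : ∀ a (h : a ∈ evenRed n 𝒜), Xe a = x (Sum.inr (Sum.inl ⟨a, h⟩)) := fun a h => dif_pos h
  have hXo : ∀ a (h : a ∈ oddRed n 𝒜 B), Xo a = x (Sum.inr (Sum.inr ⟨a, h⟩)) := fun a h => dif_pos h
  have hs : mk 𝒜 B c d = ∑ a ∈ 𝒜, Xr a + (∑ e ∈ evenRed n 𝒜, Xe e + ∑ o ∈ oddRed n 𝒜 B, Xo o) := by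
    rw [hsum, Fintype.sum_sum_type, Fintype.sum_sum_type]
    rw [← Finset.sum_coe_sort 𝒜, ← Finset.sum_coe_sort (evenRed n 𝒜),
      ← Finset.sum_coe_sort (oddRed n 𝒜 B)]
    congr 1
    · exact Finset.sum_congr rfl fun a _ => (hXr a.1 a.2).symm
    congr 1
    · exact Finset.sum_congr rfl fun a _ => (hXe a.1 a.2).symm
    · exact Finset.sum_congr rfl fun a _ => (hXo a.1 a.2).symm
  -- properties
  have r0 : ∀ a ∈ 𝒜, ∀ α ∈ 𝒜, α ≠ a → cA (Xr a) α = 0 := fun a ha α hα hne => by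
    rw [hXr a ha, cA_of_mem _ hα]
    exact (hx (Sum.inl ⟨a, ha⟩)).1 _ (by simpa using hne)
  have r0' : ∀ a ∈ 𝒜, ∀ β ∈ B, dB (Xr a) β = 0 := fun a ha β hβ => by
    rw [hXr a ha, dB_of_mem _ hβ]
    exact (hx (Sum.inl ⟨a, ha⟩)).1 _ (by simp)
  have r1 : ∀ a ∈ 𝒜, 0 ≤ cA (Xr a) a := fun a ha => by
    have := (hx (Sum.inl ⟨a, ha⟩)).2.2 (fun i => Real.exp ((0 : Fin n → ℝ) i))
      (fun i => (Real.exp_pos _).ne')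
    rw [← hXr a ha] at this
    unfold F at this
    simp only [mon_exp, zero_dotProduct, Real.exp_zero, mul_one] at this
    rw [Finset.sum_eq_zero (s := B) (fun β hβ => by rw [r0' a ha β hβ, zero_mul]), add_zero,
      Finset.sum_eq_single a (fun α hα hne => r0 a ha α hα hne) (fun h => absurd ha h)] at this
    exact this
  have e0 : ∀ e ∈ evenRed n 𝒜, ∀ α ∈ 𝒜, ¬ (α ∈ e.1 ∨ α = e.2) → cA (Xe e) α = 0 :=
    fun e he α hα hne => by
      rw [hXe e he, cA_of_mem _ hα]
      exact (hx (Sum.inr (Sum.inl ⟨e, he⟩))).1 _ (by simpa [hα] using hne)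
  have e0' : ∀ e ∈ evenRed n 𝒜, ∀ β ∈ B, dB (Xe e) β = 0 := fun e he β hβ => by
    rw [hXe e he, dB_of_mem _ hβ]
    exact (hx (Sum.inr (Sum.inl ⟨e, he⟩))).1 _ (by simp)
  have o0 : ∀ e ∈ oddRed n 𝒜 B, ∀ α ∈ 𝒜, α ∉ e.1 → cA (Xo e) α = 0 :=
    fun e he α hα hne => by
      rw [hXo e he, cA_of_mem _ hα]
      exact (hx (Sum.inr (Sum.inr ⟨e, he⟩))).1 _ (by simpa [hα] using hne)
  have o0' : ∀ e ∈ oddRed n 𝒜 B, ∀ β ∈ B, β ≠ e.2 → dB (Xo e) β = 0 := fun e he β hβ hne => by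
    rw [hXo e he, dB_of_mem _ hβ]
    exact (hx (Sum.inr (Sum.inr ⟨e, he⟩))).1 _ (by simpa using hne)
  refine ⟨fun α => cA (Xr α) α, fun e => cA (Xe e), fun o => cA (Xo o), fun o => dB (Xo o) o.2,
    r1, ?_, ?_, ?_, ?_⟩
  · intro e he
    obtain ⟨hA, hβ, hR⟩ := even_mem he
    refine ⟨fun α hα => ?_, fun y hy => ?_⟩
    · dsimp only
      rw [hXe e he, cA_of_mem _ (hA hα)]
      refine (hx (Sum.inr (Sum.inl ⟨e, he⟩))).2.1 _ ?_
      intro h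
      have : α = e.2 := by simpa using h
      exact hR.2.2.1 (this ▸ hα)
    · have := (hx (Sum.inr (Sum.inl ⟨e, he⟩))).2.2 y hy
      rw [← hXe e he] at this
      unfold F at this
      rw [Finset.sum_eq_zero (s := B) (fun β hβ => by rw [e0' e he β hβ, zero_mul]), add_zero,
        ← Finset.sum_subset (Finset.insert_subset hβ hA) (fun α hα hne => by
          rw [e0 e he α hα (fun h => hne (Finset.mem_insert.2 h.symm)), zero_mul]),
        Finset.sum_insert hR.2.2.1] at this
      linarith
  · intro e he
    obtain ⟨hA, hβ, hR⟩ := odd_mem he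
    refine ⟨fun α hα => ?_, fun y hy => ?_⟩
    · dsimp only
      rw [hXo e he, cA_of_mem _ (hA hα)]
      exact (hx (Sum.inr (Sum.inr ⟨e, he⟩))).2.1 _ (by simp)
    · have := (hx (Sum.inr (Sum.inr ⟨e, he⟩))).2.2 y hy
      rw [← hXo e he] at this
      unfold F at this
      rw [Finset.sum_eq_single (s := B) e.2 (fun β hβ hne => by rw [o0' e he β hβ hne, zero_mul])
          (fun h => absurd hβ h),
        ← Finset.sum_subset hA (fun α hα hne => by rw [o0 e he α hα hne, zero_mul])] at this
      exact this
  · intro α hα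
    have := congrArg (fun v => cA v α) hs
    simp only [cA_add, cA_sum, cA_mk c d hα] at this
    rw [this, ← add_assoc]
    congr 1
    · congr 1
      · exact Finset.sum_eq_single α (fun a ha hne => r0 a ha α hα hne.symm) (fun h => absurd hα h)
      · refine Finset.sum_congr rfl fun e he => ?_
        split_ifs with h
        · rfl
        · exact e0 e he α hα h
    · refine Finset.sum_congr rfl fun e he => ?_
      split_ifs with h
      · rfl
      · exact o0 e he α hα h
  · intro β hβ
    have := congrArg (fun v => dB v β) hs
    simp only [dB_add, dB_sum, dB_mk c d hβ] at this
    rw [this, Finset.sum_eq_zero (fun a ha => r0' a ha β hβ),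
      Finset.sum_eq_zero (fun a ha => e0' a ha β hβ), zero_add, zero_add]
    refine Finset.sum_congr rfl fun e he => ?_
    split_ifs with h
    · dsimp only
      rw [h]
    · exact o0' e he β hβ (Ne.symm h)

theorem inSCone_of_fintype {ι : Type} [Fintype ι] (cs : ι → (Fin n → ℝ) → ℝ)
    (ds : ι → (Fin n → ℕ) → ℝ) (h : ∀ j, IsNonnegAG n 𝒜 B (cs j) (ds j)) (c d)
    (hc : ∀ α ∈ 𝒜, c α = ∑ j, cs j α) (hd : ∀ β ∈ B, d β = ∑ j, ds j β) :
    InSCone n 𝒜 B c d := by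
  refine ⟨Fintype.card ι, fun k => cs ((Fintype.equivFin ι).symm k),
    fun k => ds ((Fintype.equivFin ι).symm k), fun _ => 1, fun k => ⟨zero_le_one, h _⟩, ?_, ?_⟩
  · intro α hα
    rw [hc α hα]; simp only [one_mul]
    exact (Equiv.sum_comp (Fintype.equivFin ι).symm (fun j => cs j α)).symm
  · intro α hα
    rw [hd α hα]; simp only [one_mul]
    exact (Equiv.sum_comp (Fintype.equivFin ι).symm (fun j => ds j α)).symm

theorem split_SCone (c : (Fin n → ℝ) → ℝ) (d : (Fin n → ℕ) → ℝ)
      (t : (Fin n → ℝ) → ℝ)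
        (u : Finset (Fin n → ℝ) × (Fin n → ℝ) → (Fin n → ℝ) → ℝ)
        (w : Finset (Fin n → ℝ) × (Fin n → ℕ) → (Fin n → ℝ) → ℝ)
        (r : Finset (Fin n → ℝ) × (Fin n → ℕ) → ℝ)
        (h1 : ∀ α ∈ 𝒜, 0 ≤ t α)
        (h2 : ∀ Aβ ∈ evenRed n 𝒜, InPeMon n Aβ.1 Aβ.2 (u Aβ))
        (h3 : ∀ Aβ ∈ oddRed n 𝒜 B, InPoMon n Aβ.1 Aβ.2 (w Aβ) (r Aβ))
        (h4 : ∀ α ∈ 𝒜, c α = t α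
          + ∑ Aβ ∈ evenRed n 𝒜, (if α ∈ Aβ.1 ∨ α = Aβ.2 then u Aβ α else 0)
          + ∑ Aβ ∈ oddRed n 𝒜 B, (if α ∈ Aβ.1 then w Aβ α else 0))
        (h5 : ∀ β ∈ B, d β = ∑ Aβ ∈ oddRed n 𝒜 B, (if Aβ.2 = β then r Aβ else 0)) :
    InSCone n 𝒜 B c d := by
  refine inSCone_of_fintype (ι := J 𝒜 B)
    (Sum.elim (fun a α => if a.1 = α then t a.1 else 0)
      (Sum.elim (fun e α => if α ∈ e.1.1 ∨ α = e.1.2 then u e.1 α else 0)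
        (fun o α => if α ∈ o.1.1 then w o.1 α else 0)))
    (Sum.elim (fun _ _ => 0) (Sum.elim (fun _ _ => 0) (fun o β => if o.1.2 = β then r o.1 else 0)))
    ?_ c d ?_ ?_
  · rintro (⟨a, ha⟩ | ⟨e, he⟩ | ⟨o, ho⟩)
    · simp only [Sum.elim_inl]
      have hnn : ∀ α, 0 ≤ if a = α then t a else 0 := fun α => by
        split_ifs
        · exact h1 a ha
        · exact le_refl _
      refine ⟨Or.inr ⟨fun α _ => hnn α, by simp⟩, fun x hx => ?_⟩
      simp only [zero_mul, Finset.sum_const_zero, add_zero, mon_abs x hx]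
      exact Finset.sum_nonneg fun α _ => mul_nonneg (hnn α) (Real.exp_pos _).le
    · simp only [Sum.elim_inl, Sum.elim_inr]
      obtain ⟨hA, hβ, hR⟩ := even_mem he
      obtain ⟨k1, k2⟩ := h2 e he
      have hneg : ∀ α, (if α ∈ e.1 ∨ α = e.2 then u e α else 0) < 0 → α = e.2 := by
        intro α hlt
        by_contra hne
        simp only [hne, or_false] at hlt
        split_ifs at hlt with h
        · exact absurd (k1 α h) (not_le.2 hlt)
        · exact lt_irrefl _ hlt
      refine ⟨Or.inl ⟨fun _ _ => rfl, ?_⟩, fun x hx => ?_⟩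
      · rw [Finset.card_le_one]
        intro a ha b hb
        rw [hneg a (Finset.mem_filter.1 ha).2, hneg b (Finset.mem_filter.1 hb).2]
      · have := k2 x hx
        simp only [zero_mul, Finset.sum_const_zero, add_zero]
        rw [← Finset.sum_subset (Finset.insert_subset hβ hA) (fun α hα hne => by
          rw [if_neg (fun h => hne (Finset.mem_insert.2 h.symm)), zero_mul]),
          Finset.sum_insert hR.2.2.1, if_pos (Or.inr rfl),
          Finset.sum_congr rfl fun α hα => by rw [if_pos (Or.inl hα)]]
        linarith
    · simp only [Sum.elim_inr]
      obtain ⟨hA, hβ, hR⟩ := odd_mem ho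
      obtain ⟨k1, k2⟩ := h3 o ho
      refine ⟨Or.inr ⟨fun α _ => ?_, ?_⟩, fun x hx => ?_⟩
      · dsimp only
        split_ifs with h
        · exact k1 α h
        · exact le_refl _
      · rw [Finset.card_le_one]
        intro a ha b hb
        have key : ∀ a, (if o.2 = a then r o else 0) ≠ 0 → o.2 = a := fun a h => by
          by_contra hne; exact h (if_neg hne)
        rw [← key a (Finset.mem_filter.1 ha).2, ← key b (Finset.mem_filter.1 hb).2]
      · have := k2 x hx
        rw [sum_sub _ hA]
        simpa [hβ] using this
  · intro α hα
    rw [h4 α hα, Fintype.sum_sum_type, Fintype.sum_sum_type]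
    simp only [Sum.elim_inl, Sum.elim_inr]
    rw [Finset.sum_coe_sort 𝒜 (fun a => if a = α then t a else 0),
      Finset.sum_coe_sort (evenRed n 𝒜) (fun e => if α ∈ e.1 ∨ α = e.2 then u e α else 0),
      Finset.sum_coe_sort (oddRed n 𝒜 B) (fun e => if α ∈ e.1 then w e α else 0),
      Finset.sum_ite_eq' 𝒜 α, if_pos hα, add_assoc]
  · intro β hβ
    rw [h5 β hβ, Fintype.sum_sum_type, Fintype.sum_sum_type]
    simp only [Sum.elim_inl, Sum.elim_inr, Finset.sum_const_zero, zero_add]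
    rw [Finset.sum_coe_sort (oddRed n 𝒜 B) (fun e => if e.2 = β then r e else 0)]

end
end SC

/-- Decomposition of the S-cone: `C_S(𝒜, B)` is the Minkowski sum of the rays spanned by
the unit vectors `e_α` (`α ∈ 𝒜`), the cones `Pᵉ(A, β)` over even reduced circuits and the
cones `Pᵒ(A, β)` over odd reduced circuits, each embedded by extension by zero. -/
theorem stmt18 (n : ℕ) (𝒜 : Finset (Fin n → ℝ)) (h𝒜 : 𝒜.Nonempty)
    (B : Finset (Fin n → ℕ)) (hBodd : ∀ β ∈ B, ∃ i, Odd (β i))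
    (hdisj : ∀ β ∈ B, natEmb n β ∉ 𝒜)
    (c : (Fin n → ℝ) → ℝ) (d : (Fin n → ℕ) → ℝ) :
    InSCone n 𝒜 B c d ↔
      ∃ (t : (Fin n → ℝ) → ℝ)
        (u : Finset (Fin n → ℝ) × (Fin n → ℝ) → (Fin n → ℝ) → ℝ)
        (w : Finset (Fin n → ℝ) × (Fin n → ℕ) → (Fin n → ℝ) → ℝ)
        (r : Finset (Fin n → ℝ) × (Fin n → ℕ) → ℝ),
        (∀ α ∈ 𝒜, 0 ≤ t α) ∧
        (∀ Aβ ∈ evenRed n 𝒜, InPeMon n Aβ.1 Aβ.2 (u Aβ)) ∧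
        (∀ Aβ ∈ oddRed n 𝒜 B, InPoMon n Aβ.1 Aβ.2 (w Aβ) (r Aβ)) ∧
        (∀ α ∈ 𝒜, c α = t α
          + ∑ Aβ ∈ evenRed n 𝒜, (if α ∈ Aβ.1 ∨ α = Aβ.2 then u Aβ α else 0)
          + ∑ Aβ ∈ oddRed n 𝒜 B, (if α ∈ Aβ.1 then w Aβ α else 0)) ∧
        (∀ β ∈ B, d β = ∑ Aβ ∈ oddRed n 𝒜 B, (if Aβ.2 = β then r Aβ else 0)) := by
  constructor
  · intro h
    exact SC.K_split c d (SC.SCone_mem h𝒜 hBodd hdisj c d h)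
  · rintro ⟨t, u, w, r, h1, h2, h3, h4, h5⟩
    exact SC.split_SCone c d t u w r h1 h2 h3 h4 h5
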